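/- arXiv:2207.03869 — 3 statements merged into one kernel-verified Lean document; each statement's English description precedes it below -/
import Mathlib

section
/- If G is a finite simple graph with maximum degree Δ = 7 and mad(G) < 5, then χ'_ℓ(G) ≤ 8. -/
open scoped Classical

/-- A proper edge-coloring of `G` from the lists `L`: every edge receives a color
from its list, and distinct edges sharing a vertex receive distinct colors. -/
def IsProperListEdgeColoring {V : Type*} (G : SimpleGraph V)
    (L : Sym2 V → Finset ℕ) (f : Sym2 V → ℕ) : Prop :=
  (∀ e ∈ G.edgeSet, f e ∈ L e) ∧
    ∀ e₁ ∈ G.edgeSet, ∀ e₂ ∈ G.edgeSet, e₁ ≠ e₂ → (∃ v, v ∈ e₁ ∧ v ∈ e₂) →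
      f e₁ ≠ f e₂

/-- `G` is `k`-list-edge-colorable: for every edge-list-assignment `L` with all
lists of size at least `k`, `G` has a proper edge-coloring from the lists. -/
def ListEdgeColorable {V : Type*} (G : SimpleGraph V) (k : ℕ) : Prop :=
  ∀ L : Sym2 V → Finset ℕ, (∀ e ∈ G.edgeSet, k ≤ (L e).card) →
    ∃ f : Sym2 V → ℕ, IsProperListEdgeColoring G L f

/-- The list-chromatic index: the least `k` such that `G` is `k`-list-edge-colorable. -/
noncomputable def listChromaticIndex {V : Type*} (G : SimpleGraph V) : ℕ :=
  sInf {k | ListEdgeColorable G k}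

/-- `G` is `k`-list-edge-critical: `χ'ₗ(G) > k` and `χ'ₗ(G - e) ≤ k` for every edge `e`. -/
def ListEdgeCritical {V : Type*} (G : SimpleGraph V) (k : ℕ) : Prop :=
  k < listChromaticIndex G ∧
    ∀ e ∈ G.edgeSet, listChromaticIndex (G.deleteEdges {e}) ≤ k

/-- `mad(G) < m`: every nonempty subgraph `H` of `G` has average degree less than `m`. -/
def MadLT {V : Type*} [Fintype V] (G : SimpleGraph V) (m : ℝ) : Prop :=
  ∀ H : G.Subgraph, H.verts.Nonempty →
    (∑ v ∈ H.verts.toFinset, ((H.neighborSet v).ncard : ℝ)) / (H.verts.toFinset.card : ℝ) < m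


namespace BipartiteListColoring

variable {V : Type*}

/-- No two distinct pairs in `M` share a first or a second coordinate. -/
def IsMatchingSet (M : Finset (V × V)) : Prop :=
  ∀ e ∈ M, ∀ f ∈ M, e ≠ f → e.1 ≠ f.1 ∧ e.2 ≠ f.2

/-- The labels `c` are distinct on distinct pairs of `E` that share a coordinate. -/
def IsProperOn (c : V × V → ℤ) (E : Finset (V × V)) : Prop :=
  ∀ e ∈ E, ∀ f ∈ E, e ≠ f → (e.1 = f.1 ∨ e.2 = f.2) → c e ≠ c f

/-- The pair `f` dominates `e`: larger labels win at first coordinates and smaller labels win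
at second coordinates. -/
def Dominates (c : V × V → ℤ) (f e : V × V) : Prop :=
  (f.1 = e.1 ∧ c e < c f) ∨ (f.2 = e.2 ∧ c f < c e)

/-- The number of pairs in `E` with first coordinate `u`. -/
noncomputable def degFst (E : Finset (V × V)) (u : V) : ℕ := (E.filter fun e => e.1 = u).card

/-- The number of pairs in `E` with second coordinate `w`. -/
noncomputable def degSnd (E : Finset (V × V)) (w : V) : ℕ := (E.filter fun e => e.2 = w).card

/-- Stable matchings exist. -/
lemma exists_kernel (c : V × V → ℤ) (S : Finset (V × V)) (hc : IsProperOn c S) :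
    ∃ K ⊆ S, IsMatchingSet K ∧ ∀ e ∈ S, e ∉ K → ∃ f ∈ K, Dominates c f e := by
  induction S using Finset.strongInduction with
  | H S ih =>
  set T := S.filter fun e => ∀ f ∈ S, f.1 = e.1 → c f ≤ c e with hT
  by_cases hm : ∀ e ∈ T, ∀ f ∈ T, e ≠ f → e.2 ≠ f.2
  · refine ⟨T, Finset.filter_subset _ _, ?_, ?_⟩
    · intro e he f hf hne
      refine ⟨fun h => ?_, hm e he f hf hne⟩
      simp only [hT, Finset.mem_filter] at he hf
      exact hc e he.1 f hf.1 hne (Or.inl h)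
        (le_antisymm (hf.2 e he.1 h) (he.2 f hf.1 h.symm))
    · intro e he heT
      obtain ⟨f, hf, hmax⟩ := (S.filter fun f => f.1 = e.1).exists_max_image c
        ⟨e, by simp [he]⟩
      simp only [Finset.mem_filter] at hf hmax
      have hfT : f ∈ T := by
        simp only [hT, Finset.mem_filter]
        exact ⟨hf.1, fun g hg hgf => hmax g ⟨hg, hgf.trans hf.2⟩⟩
      have hne : e ≠ f := fun h => heT (h ▸ hfT)
      refine ⟨f, hfT, Or.inl ⟨hf.2, lt_of_le_of_ne (hmax e ⟨he, rfl⟩) ?_⟩⟩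
      exact hc e he f hf.1 hne (Or.inl hf.2.symm)
  · obtain ⟨e, he, f, hf, h2, hlt⟩ : ∃ e ∈ T, ∃ f ∈ T, e.2 = f.2 ∧ c e < c f := by
      push Not at hm
      obtain ⟨e, he, f, hf, hne, h2⟩ := hm
      have := hc e (Finset.mem_filter.1 he).1 f (Finset.mem_filter.1 hf).1 hne (Or.inr h2)
      rcases lt_or_gt_of_ne this with h | h
      · exact ⟨e, he, f, hf, h2, h⟩
      · exact ⟨f, hf, e, he, h2.symm, h⟩
    simp only [hT, Finset.mem_filter] at he hf
    obtain ⟨K, hKS, hK, hdom⟩ := ih (S.erase f) (Finset.erase_ssubset hf.1)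
      (fun a ha b hb => hc a (Finset.mem_of_mem_erase ha) b (Finset.mem_of_mem_erase hb))
    refine ⟨K, hKS.trans (Finset.erase_subset _ _), hK, fun g hg hgK => ?_⟩
    by_cases hgf : g = f
    · subst hgf
      by_cases heK : e ∈ K
      · exact ⟨e, heK, Or.inr ⟨h2, hlt⟩⟩
      · obtain ⟨k, hk, hd⟩ := hdom e
          (Finset.mem_erase.2 ⟨fun h => by simp [h] at hlt, he.1⟩) heK
        refine ⟨k, hk, Or.inr ?_⟩
        rcases hd with ⟨h1, hl⟩ | ⟨h1, hl⟩
        · exact absurd (he.2 k (Finset.mem_of_mem_erase (hKS hk)) h1) (not_le.2 hl)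
        · exact ⟨h1.trans h2, hl.trans hlt⟩
    · exact hdom g (Finset.mem_erase.2 ⟨hgf, hg⟩) hgK

/-- Galvin's argument: lists longer than the number of dominating pairs suffice. -/
lemma exists_listColoring_of_dominates (c : V × V → ℤ) (E : Finset (V × V))
    (hc : IsProperOn c E) (L : V × V → Finset ℕ)
    (hL : ∀ e ∈ E, (E.filter fun f => Dominates c f e).card < (L e).card) :
    ∃ g : V × V → ℕ, (∀ e ∈ E, g e ∈ L e) ∧
      ∀ e ∈ E, ∀ f ∈ E, e ≠ f → (e.1 = f.1 ∨ e.2 = f.2) → g e ≠ g f := by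
  induction E using Finset.strongInduction generalizing L with
  | H E ih =>
  rcases E.eq_empty_or_nonempty with rfl | ⟨e₀, he₀⟩
  · exact ⟨fun _ => 0, by simp, by simp⟩
  obtain ⟨a, ha⟩ := Finset.card_pos.1 ((Nat.zero_le _).trans_lt (hL e₀ he₀))
  obtain ⟨K, hKS, hK, hdom⟩ := exists_kernel c (E.filter fun e => a ∈ L e)
    (fun x hx y hy => hc x (Finset.mem_filter.1 hx).1 y (Finset.mem_filter.1 hy).1)
  have hKE : K ⊆ E := hKS.trans (Finset.filter_subset _ _)
  have hKne : K.Nonempty := by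
    by_cases h : e₀ ∈ K
    · exact ⟨e₀, h⟩
    · obtain ⟨f, hf, -⟩ := hdom e₀ (by simp [he₀, ha]) h
      exact ⟨f, hf⟩
  obtain ⟨g, hgL, hg⟩ := ih (E \ K)
    (Finset.sdiff_ssubset hKE hKne)
    (fun x hx y hy => hc x (Finset.mem_sdiff.1 hx).1 y (Finset.mem_sdiff.1 hy).1)
    (fun e => (L e).erase a) (by
      intro e he
      rw [Finset.mem_sdiff] at he
      have hsub : ((E \ K).filter fun f => Dominates c f e) ⊆
          E.filter fun f => Dominates c f e :=
        Finset.filter_subset_filter _ Finset.sdiff_subset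
      by_cases hae : a ∈ L e
      · obtain ⟨f, hf, hd⟩ := hdom e (by simp [he.1, hae]) he.2
        have : ((E \ K).filter fun f => Dominates c f e).card <
            (E.filter fun f => Dominates c f e).card :=
          Finset.card_lt_card ⟨hsub, fun h => by
            have := h (Finset.mem_filter.2 ⟨hKE hf, hd⟩)
            simp [hf] at this⟩
        have h2 := hL e he.1
        rw [Finset.card_erase_of_mem hae]
        omega
      · rw [Finset.erase_eq_of_notMem hae]
        exact (Finset.card_le_card hsub).trans_lt (hL e he.1))
  refine ⟨fun e => if e ∈ K then a else g e, fun e he => ?_, fun e he f hf hne hinc => ?_⟩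
  · by_cases h : e ∈ K
    · simpa [h] using (Finset.mem_filter.1 (hKS h)).2
    · simpa [h] using Finset.mem_of_mem_erase (hgL e (by simp [he, h]))
  · by_cases h : e ∈ K <;> by_cases h' : f ∈ K
    · have := hK e h f h' hne
      tauto
    · simpa [h, h'] using (Finset.ne_of_mem_erase (hgL f (by simp [hf, h']))).symm
    · simpa [h, h'] using Finset.ne_of_mem_erase (hgL e (by simp [he, h]))
    · simpa [h, h'] using hg e (by simp [he, h]) f (by simp [hf, h']) hne hinc

/-- A nonempty matching such that every pair meeting it on the left, and whose right end has
at least the degree of its left end, also meets it on the right. -/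
lemma exists_matching (E : Finset (V × V)) (hE : E.Nonempty)
    (hcard : (E.image Prod.snd).card ≤ (E.image Prod.fst).card) :
    ∃ M ⊆ E, M.Nonempty ∧ IsMatchingSet M ∧
      ∀ e ∈ E, (∃ m ∈ M, m.1 = e.1) → degFst E e.1 ≤ degSnd E e.2 → ∃ m ∈ M, m.2 = e.2 := by
  set t : V → Finset V := fun u =>
    (E.filter fun e => e.1 = u ∧ degFst E e.1 ≤ degSnd E e.2).image Prod.snd with ht
  have htmem : ∀ u w, w ∈ t u ↔ (u, w) ∈ E ∧ degFst E u ≤ degSnd E w := by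
    intro u w
    simp only [ht, Finset.mem_image, Finset.mem_filter]
    constructor
    · rintro ⟨⟨x, y⟩, ⟨h1, rfl, h2⟩, rfl⟩
      exact ⟨h1, h2⟩
    · rintro ⟨h1, h2⟩
      exact ⟨(u, w), ⟨h1, rfl, h2⟩, rfl⟩
  obtain ⟨X, hX, hmin⟩ := ((E.image Prod.fst).powerset.filter fun X =>
    X.Nonempty ∧ (X.biUnion t).card ≤ X.card).exists_min_image Finset.card
      ⟨E.image Prod.fst, by
        simp only [Finset.mem_filter, Finset.mem_powerset, Finset.Subset.refl, true_and]
        refine ⟨hE.image _, (Finset.card_le_card fun w hw => ?_).trans hcard⟩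
        obtain ⟨u, -, hw⟩ := Finset.mem_biUnion.1 hw
        exact Finset.mem_image.2 ⟨(u, w), ((htmem u w).1 hw).1, rfl⟩⟩
  simp only [Finset.mem_filter, Finset.mem_powerset] at hX hmin
  obtain ⟨hXE, hXne, hXcard⟩ := hX
  rcases (X.biUnion t).eq_empty_or_nonempty with hempty | hne
  · obtain ⟨u, hu⟩ := hXne
    obtain ⟨e, he, rfl⟩ := Finset.mem_image.1 (hXE hu)
    refine ⟨{e}, by simpa using he, by simp, by intro a; simp; aesop, ?_⟩
    rintro f hf ⟨m, hm, hmf⟩ hd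
    obtain rfl := Finset.mem_singleton.1 hm
    have : f.2 ∈ X.biUnion t :=
      Finset.mem_biUnion.2 ⟨m.1, hu, (htmem _ _).2 ⟨by rw [hmf]; exact hf, by rw [hmf]; exact hd⟩⟩
    simp [hempty] at this
  · have hall : ∀ s ⊆ X, s.card ≤ (s.biUnion t).card := by
      intro s hs
      rcases s.eq_empty_or_nonempty with rfl | hsne
      · simp
      by_contra! hlt
      obtain ⟨a, has⟩ := hsne
      have hle : ((s.erase a).biUnion t).card ≤ (s.biUnion t).card :=
        Finset.card_le_card (Finset.biUnion_subset_biUnion_of_subset_left _ (Finset.erase_subset _ _))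
      have hc := Finset.card_erase_of_mem has
      rcases (s.erase a).eq_empty_or_nonempty with h0 | h0
      · rw [h0, Finset.card_empty] at hc
        have := hmin s ⟨hs.trans hXE, ⟨a, has⟩, hlt.le⟩
        have := Finset.eq_of_subset_of_card_le hs this
        subst this
        have := hne.card_pos
        omega
      · have := hmin (s.erase a) ⟨(Finset.erase_subset _ _).trans (hs.trans hXE), h0, by omega⟩
        have := Finset.card_le_card hs
        have := Finset.card_pos.2 ⟨a, has⟩
        omega
    obtain ⟨φ, hφ, hφt⟩ := (Finset.all_card_le_biUnion_card_iff_exists_injective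
      (fun x : X => t x)).1 (by
        intro s
        have := hall (s.map (Function.Embedding.subtype _)) (by
          intro x hx
          simp only [Finset.mem_map] at hx
          obtain ⟨y, -, rfl⟩ := hx
          exact y.2)
        rw [Finset.card_map] at this
        convert this using 2
        ext w
        simp)
    have himg : Finset.univ.image φ = X.biUnion t := by
      apply Finset.eq_of_subset_of_card_le
      · intro w hw
        obtain ⟨x, -, rfl⟩ := Finset.mem_image.1 hw
        exact Finset.mem_biUnion.2 ⟨x, x.2, hφt x⟩
      · rw [Finset.card_image_of_injective _ hφ]
        simpa using hXcard
    refine ⟨Finset.univ.image fun x : X => ((x : V), φ x), ?_, ?_, ?_, ?_⟩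
    · intro e he
      obtain ⟨x, -, rfl⟩ := Finset.mem_image.1 he
      exact ((htmem _ _).1 (hφt x)).1
    · obtain ⟨u, hu⟩ := hXne
      exact ⟨_, Finset.mem_image_of_mem _ (Finset.mem_univ ⟨u, hu⟩)⟩
    · intro e he f hf hne
      obtain ⟨x, -, rfl⟩ := Finset.mem_image.1 he
      obtain ⟨y, -, rfl⟩ := Finset.mem_image.1 hf
      have hxy : x ≠ y := fun h => hne (by rw [h])
      exact ⟨fun h => hxy (Subtype.ext h), fun h => hxy (hφ h)⟩
    · rintro e he ⟨m, hm, hme⟩ hd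
      obtain ⟨x, -, rfl⟩ := Finset.mem_image.1 hm
      have : e.2 ∈ Finset.univ.image φ := by
        rw [himg]
        exact Finset.mem_biUnion.2 ⟨x, x.2, (htmem _ _).2
          ⟨by simp only at hme; rw [hme]; exact he, by simp only at hme; rw [hme]; exact hd⟩⟩
      obtain ⟨y, -, hy⟩ := Finset.mem_image.1 this
      exact ⟨(y, φ y), Finset.mem_image_of_mem _ (Finset.mem_univ y), hy⟩

/-- A proper labelling in which every pair is dominated by fewer pairs than the larger of the
degrees of its ends. -/
def IsGood (c : V × V → ℤ) (E : Finset (V × V)) : Prop :=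
  IsProperOn c E ∧ ∀ e ∈ E,
    (E.filter fun f => Dominates c f e).card < max (degFst E e.1) (degSnd E e.2)

lemma degFst_image_swap (E : Finset (V × V)) (u : V) :
    degFst (E.image Prod.swap) u = degSnd E u := by
  rw [degFst, degSnd, Finset.filter_image, Finset.card_image_of_injective _ Prod.swap_injective]
  rfl

lemma degSnd_image_swap (E : Finset (V × V)) (u : V) :
    degSnd (E.image Prod.swap) u = degFst E u := by
  rw [degFst, degSnd, Finset.filter_image, Finset.card_image_of_injective _ Prod.swap_injective]
  rfl

lemma IsGood.swap {c : V × V → ℤ} {E : Finset (V × V)} (h : IsGood c (E.image Prod.swap)) :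
    IsGood (fun e => -c e.swap) E := by
  have hmem : ∀ e ∈ E, e.swap ∈ E.image Prod.swap := fun e he => Finset.mem_image_of_mem _ he
  refine ⟨fun e he f hf hne hinc heq => ?_, fun e he => ?_⟩
  · exact h.1 _ (hmem e he) _ (hmem f hf) (fun h => hne (Prod.swap_injective h)) hinc.symm
      (neg_injective heq)
  · have := h.2 _ (hmem e he)
    rw [degFst_image_swap, degSnd_image_swap, Finset.filter_image,
      Finset.card_image_of_injective _ Prod.swap_injective, max_comm] at this
    refine (congrArg Finset.card ?_).trans_lt this
    ext f
    rw [Finset.mem_filter, Finset.mem_filter]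
    simp only [Dominates, Prod.fst_swap, Prod.snd_swap,
      neg_lt_neg_iff]
    tauto

lemma exists_isGood_of_card_le (E : Finset (V × V)) (hE : E.Nonempty)
    (hcard : (E.image Prod.snd).card ≤ (E.image Prod.fst).card)
    (ih : ∀ F ⊂ E, ∃ c, IsGood c F) : ∃ c, IsGood c E := by
  obtain ⟨M, hME, hMne, hM, hcov⟩ := exists_matching E hE hcard
  obtain ⟨c, hc, hlt⟩ := ih (E \ M) (Finset.sdiff_ssubset hME hMne)
  obtain ⟨N, hN⟩ : ∃ N : ℤ, ∀ e ∈ E, c e < N := by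
    obtain ⟨N, hN⟩ := (E.image c).bddAbove
    exact ⟨N + 1, fun e he => Int.lt_add_one_iff.2 (hN (by simpa using ⟨_, _, he, rfl⟩))⟩
  refine ⟨fun e => if e ∈ M then N else c e, fun e he f hf hne hinc => ?_, fun e he => ?_⟩
  · by_cases h : e ∈ M <;> by_cases h' : f ∈ M
    · have := hM e h f h' hne
      tauto
    · simpa [h, h'] using (hN f hf).ne'
    · simpa [h, h'] using (hN e he).ne
    · simpa [h, h'] using hc e (by simp [he, h]) f (by simp [hf, h']) hne hinc
  · by_cases h : e ∈ M
    · refine lt_of_lt_of_le (Finset.card_lt_card (t := E.filter fun f => f.2 = e.2) ⟨?_, ?_⟩)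
        (le_max_right _ _)
      · intro f hf
        simp only [Finset.mem_filter, Dominates, h, if_true] at hf ⊢
        refine ⟨hf.1, ?_⟩
        rcases hf.2 with ⟨-, h1⟩ | h1
        · by_cases hfM : f ∈ M
          · simp [hfM] at h1
          · simp only [hfM, if_false] at h1
            exact absurd (hN f hf.1) (not_lt.2 h1.le)
        · exact h1.1
      · intro hsub
        have := (Finset.mem_filter.1 (hsub (Finset.mem_filter.2 ⟨he, rfl⟩))).2
        simp [Dominates] at this
    · have hle := hlt e (by simp [he, h])
      set A := (E \ M).filter fun f => Dominates c f e
      set B := M.filter fun f => f.1 = e.1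
      have hB : B.card ≤ 1 := Finset.card_le_one.2 fun x hx y hy => by
        by_contra hne
        simp only [B, Finset.mem_filter] at hx hy
        exact (hM x hx.1 y hy.1 hne).1 (hx.2.trans hy.2.symm)
      have hsub : (E.filter fun f => Dominates (fun e => if e ∈ M then N else c e) f e) ⊆
          A ∪ B := by
        intro f hf
        simp only [Finset.mem_filter, Dominates, h, if_false] at hf
        by_cases hfM : f ∈ M
        · simp only [hfM, if_true] at hf
          rcases hf.2 with h1 | h1
          · exact Finset.mem_union_right _ (Finset.mem_filter.2 ⟨hfM, h1.1⟩)
          · exact absurd h1.2 (not_lt.2 (hN e he).le)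
        · simp only [hfM, if_false] at hf
          exact Finset.mem_union_left _ (Finset.mem_filter.2 ⟨by simp [hf.1, hfM], hf.2⟩)
      have hAB := (Finset.card_le_card hsub).trans (Finset.card_union_le _ _)
      have hmono1 : degFst (E \ M) e.1 + B.card = degFst E e.1 := by
        rw [degFst, degFst, ← Finset.card_union_of_disjoint]
        · congr 1
          ext f
          simp only [B, Finset.mem_union, Finset.mem_filter, Finset.mem_sdiff]
          have := @hME f
          tauto
        · rw [Finset.disjoint_left]
          intro f
          simp only [B, Finset.mem_filter, Finset.mem_sdiff]
          tauto
      have hmono2 : degSnd (E \ M) e.2 ≤ degSnd E e.2 :=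
        Finset.card_le_card (Finset.filter_subset_filter _ Finset.sdiff_subset)
      rcases B.eq_empty_or_nonempty with hB0 | ⟨m, hm⟩
      · rw [hB0, Finset.card_empty] at hAB hmono1
        exact hAB.trans_lt (by omega)
      · have hB1 : B.card = 1 := le_antisymm hB (Finset.card_pos.2 ⟨m, hm⟩)
        simp only [B, Finset.mem_filter] at hm
        by_cases hd : degFst E e.1 ≤ degSnd E e.2
        · obtain ⟨m', hm', h2⟩ := hcov e he ⟨m, hm⟩ hd
          have : degSnd (E \ M) e.2 < degSnd E e.2 :=
            Finset.card_lt_card ⟨Finset.filter_subset_filter _ Finset.sdiff_subset, fun hs => by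
              have := hs (Finset.mem_filter.2 ⟨hME hm', h2⟩)
              simp [hm'] at this⟩
          omega
        · omega

lemma exists_isGood (E : Finset (V × V)) : ∃ c, IsGood c E := by
  induction hn : E.card using Nat.strong_induction_on generalizing E with
  | _ n ih =>
  subst hn
  rcases E.eq_empty_or_nonempty with rfl | hE
  · exact ⟨fun _ => 0, by simp [IsProperOn], by simp⟩
  rcases le_total (E.image Prod.snd).card (E.image Prod.fst).card with h | h
  · exact exists_isGood_of_card_le E hE h fun F hF => ih _ (Finset.card_lt_card hF) F rfl
  · obtain ⟨c, hc⟩ := exists_isGood_of_card_le (E.image Prod.swap) (hE.image _)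
      (by simpa [Finset.image_image, Function.comp_def] using h)
      fun F hF => ih _ ((Finset.card_lt_card hF).trans_eq
        (Finset.card_image_of_injective _ Prod.swap_injective)) F rfl
    exact ⟨_, hc.swap⟩

/-- The Borodin–Kostochka–Woodall theorem: a bipartite graph can be edge-colored from lists
whose sizes are at least the larger of the degrees of the ends. -/
theorem exists_listColoring (E : Finset (V × V)) (L : V × V → Finset ℕ)
    (hL : ∀ e ∈ E, max (degFst E e.1) (degSnd E e.2) ≤ (L e).card) :
    ∃ g : V × V → ℕ, (∀ e ∈ E, g e ∈ L e) ∧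
      ∀ e ∈ E, ∀ f ∈ E, e ≠ f → (e.1 = f.1 ∨ e.2 = f.2) → g e ≠ g f := by
  obtain ⟨c, hc, hlt⟩ := exists_isGood E
  exact exists_listColoring_of_dominates c E hc L fun e he => (hlt e he).trans_le (hL e he)

/-- If every nonempty subset of `E` has a vertex of small degree, then `E` is small. -/
lemma card_le_sum_of_degenerate (a b : V → ℕ) (E : Finset (V × V))
    (h : ∀ F ⊆ E, F.Nonempty →
      ∃ e ∈ F, degFst F e.1 ≤ a e.1 ∨ degSnd F e.2 ≤ b e.2) :
    E.card ≤ ∑ u ∈ E.image Prod.fst, a u + ∑ w ∈ E.image Prod.snd, b w := by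
  induction E using Finset.strongInduction with
  | H E ih =>
  rcases E.eq_empty_or_nonempty with rfl | hE
  · simp
  obtain ⟨e, he, hdeg⟩ := h E subset_rfl hE
  have key : ∀ F ⊆ E, e ∉ F →
      F.card ≤ ∑ u ∈ F.image Prod.fst, a u + ∑ w ∈ F.image Prod.snd, b w := fun F hF heF =>
    ih F ⟨hF, fun h => heF (h he)⟩ fun F' hF' => h F' (hF'.trans hF)
  rcases hdeg with hd | hd
  · obtain ⟨F, hF⟩ : ∃ F, F = E \ E.filter fun f => f.1 = e.1 := ⟨_, rfl⟩
    have hFE : F ⊆ E := hF ▸ Finset.sdiff_subset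
    have h1 := key F hFE (by simp [hF])
    have h2 : F.card + degFst E e.1 = E.card := by
      rw [hF]
      exact Finset.card_sdiff_add_card_eq_card (Finset.filter_subset _ _)
    have h3 : a e.1 + ∑ u ∈ F.image Prod.fst, a u ≤ ∑ u ∈ E.image Prod.fst, a u := by
      rw [← Finset.sum_insert (by simp [hF])]
      exact Finset.sum_le_sum_of_subset
        (Finset.insert_subset (Finset.mem_image_of_mem _ he) (Finset.image_subset_image hFE))
    have h4 := Finset.sum_le_sum_of_subset (f := b) (Finset.image_subset_image (f := Prod.snd) hFE)
    omega
  · obtain ⟨F, hF⟩ : ∃ F, F = E \ E.filter fun f => f.2 = e.2 := ⟨_, rfl⟩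
    have hFE : F ⊆ E := hF ▸ Finset.sdiff_subset
    have h1 := key F hFE (by simp [hF])
    have h2 : F.card + degSnd E e.2 = E.card := by
      rw [hF]
      exact Finset.card_sdiff_add_card_eq_card (Finset.filter_subset _ _)
    have h3 : b e.2 + ∑ u ∈ F.image Prod.snd, b u ≤ ∑ u ∈ E.image Prod.snd, b u := by
      rw [← Finset.sum_insert (by simp [hF])]
      exact Finset.sum_le_sum_of_subset
        (Finset.insert_subset (Finset.mem_image_of_mem _ he) (Finset.image_subset_image hFE))
    have h4 := Finset.sum_le_sum_of_subset (f := a) (Finset.image_subset_image (f := Prod.fst) hFE)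
    omega

end BipartiteListColoring

open BipartiteListColoring

/-- If the pairs in `E` are edges of a bipartite subgraph in which the degree conditions of the
Borodin–Kostochka–Woodall theorem survive after coloring the rest of the graph, then it suffices
to color the rest of the graph. -/
lemma listEdgeColorable_of_deleteEdges {V : Type*} [Fintype V] (G : SimpleGraph V) (k : ℕ)
    (E : Finset (V × V)) (hadj : ∀ e ∈ E, G.Adj e.1 e.2)
    (hbip : ∀ e ∈ E, ∀ f ∈ E, e.1 ≠ f.2)
    (hdeg : ∀ e ∈ E, G.degree e.1 + G.degree e.2 ≤ k + min (degFst E e.1) (degSnd E e.2))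
    (h : ListEdgeColorable (G.deleteEdges {x | ∃ e ∈ E, s(e.1, e.2) = x}) k) :
    ListEdgeColorable G k := by
  intro L hL
  set G' := G.deleteEdges {x | ∃ e ∈ E, s(e.1, e.2) = x} with hG'
  have hle : G' ≤ G := SimpleGraph.deleteEdges_le _
  obtain ⟨f, hfL, hf⟩ := h L fun e he => hL e (SimpleGraph.edgeSet_mono hle he)
  set C : V → Finset ℕ := fun u => (G'.neighborFinset u).image fun w => f s(u, w) with hC
  have hnot : ∀ u w, G'.Adj u w → ∀ e ∈ E, s(e.1, e.2) ≠ s(u, w) := by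
    intro u w huw e he heq
    rw [hG', SimpleGraph.deleteEdges_adj] at huw
    exact huw.2 ⟨e, he, heq⟩
  have hdegC : ∀ (u : V) (T : Finset V), (∀ w ∈ T, ∃ e ∈ E, s(e.1, e.2) = s(u, w)) →
      (C u).card + T.card ≤ G.degree u := by
    intro u T hT
    have hdisj : Disjoint (G'.neighborFinset u) T := by
      rw [Finset.disjoint_left]
      intro w hw hwT
      obtain ⟨e, he, heq⟩ := hT w hwT
      exact hnot u w (by simpa using hw) e he heq
    calc (C u).card + T.card ≤ (G'.neighborFinset u).card + T.card :=
          Nat.add_le_add_right Finset.card_image_le _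
      _ = (G'.neighborFinset u ∪ T).card := (Finset.card_union_of_disjoint hdisj).symm
      _ ≤ (G.neighborFinset u).card := by
          apply Finset.card_le_card
          intro w hw
          rw [SimpleGraph.mem_neighborFinset]
          rcases Finset.mem_union.1 hw with hw | hw
          · exact hle (by simpa using hw)
          · obtain ⟨e, he, heq⟩ := hT w hw
            rw [← SimpleGraph.mem_edgeSet, ← heq]
            exact hadj e he
      _ = G.degree u := G.card_neighborFinset_eq_degree u
  have hdegFst : ∀ u, (C u).card + degFst E u ≤ G.degree u := by
    intro u
    have := hdegC u ((E.filter fun e => e.1 = u).image Prod.snd) (by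
      intro w hw
      obtain ⟨e, he, rfl⟩ := Finset.mem_image.1 hw
      rw [Finset.mem_filter] at he
      exact ⟨e, he.1, by rw [he.2]⟩)
    have hcard : ((E.filter fun e => e.1 = u).image Prod.snd).card = degFst E u := by
      refine Finset.card_image_of_injOn fun e he f hf hef => ?_
      simp only [Finset.coe_filter, Set.mem_ofPred_eq] at he hf
      exact Prod.ext (he.2.trans hf.2.symm) hef
    rwa [hcard] at this
  have hdegSnd : ∀ u, (C u).card + degSnd E u ≤ G.degree u := by
    intro u
    have := hdegC u ((E.filter fun e => e.2 = u).image Prod.fst) (by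
      intro w hw
      obtain ⟨e, he, rfl⟩ := Finset.mem_image.1 hw
      rw [Finset.mem_filter] at he
      exact ⟨e, he.1, by rw [he.2, Sym2.eq_swap]⟩)
    have hcard : ((E.filter fun e => e.2 = u).image Prod.fst).card = degSnd E u := by
      refine Finset.card_image_of_injOn fun e he f hf hef => ?_
      simp only [Finset.coe_filter, Set.mem_ofPred_eq] at he hf
      exact Prod.ext hef (he.2.trans hf.2.symm)
    rwa [hcard] at this
  obtain ⟨g, hgL, hg⟩ := exists_listColoring E
    (fun e => L s(e.1, e.2) \ (C e.1 ∪ C e.2)) (by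
      intro e he
      have h1 := hL s(e.1, e.2) (hadj e he)
      have h2 := Finset.le_card_sdiff (C e.1 ∪ C e.2) (L s(e.1, e.2))
      have h3 := Finset.card_union_le (C e.1) (C e.2)
      have h4 := hdegFst e.1
      have h5 := hdegSnd e.2
      have h6 := hdeg e he
      omega)
  set F : Sym2 V → ℕ := fun x => if hx : ∃ e ∈ E, s(e.1, e.2) = x then g hx.choose else f x
    with hF
  have hFE : ∀ e ∈ E, F s(e.1, e.2) = g e := by
    intro e he
    have hx : ∃ e' ∈ E, s(e'.1, e'.2) = s(e.1, e.2) := ⟨e, he, rfl⟩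
    simp only [hF, dif_pos hx]
    congr 1
    rcases Sym2.eq_iff.1 hx.choose_spec.2 with h | h
    · exact Prod.ext h.1 h.2
    · exact absurd h.1 (hbip _ hx.choose_spec.1 _ he)
  have hFG : ∀ x ∈ G'.edgeSet, F x = f x := by
    intro x hx
    simp only [hF]
    rw [dif_neg]
    rintro ⟨e, he, rfl⟩
    exact hnot _ _ hx e he rfl
  have hcases : ∀ x ∈ G.edgeSet, x ∈ G'.edgeSet ∨ ∃ e ∈ E, s(e.1, e.2) = x := by
    intro x hx
    by_cases hxE : ∃ e ∈ E, s(e.1, e.2) = x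
    · exact Or.inr hxE
    · left
      rw [hG', SimpleGraph.edgeSet_deleteEdges]
      exact ⟨hx, hxE⟩
  have hmix : ∀ e ∈ E, ∀ y ∈ G'.edgeSet, (∃ v, v ∈ s(e.1, e.2) ∧ v ∈ y) → g e ≠ f y := by
    rintro e he y hy ⟨v, hve, hvy⟩ heq
    obtain ⟨w, rfl⟩ := Sym2.mem_iff_exists.1 hvy
    have hCv : f s(v, w) ∈ C v :=
      Finset.mem_image.2 ⟨w, by simpa using hy, rfl⟩
    have := (Finset.mem_sdiff.1 (hgL e he)).2
    rw [heq, Finset.mem_union, not_or] at this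
    rcases Sym2.mem_iff.1 hve with rfl | rfl
    · exact this.1 hCv
    · exact this.2 hCv
  refine ⟨F, fun x hx => ?_, fun x hx y hy hne hv => ?_⟩
  · rcases hcases x hx with h | ⟨e, he, rfl⟩
    · rw [hFG x h]
      exact hfL x h
    · rw [hFE e he]
      exact (Finset.mem_sdiff.1 (hgL e he)).1
  · rcases hcases x hx with hx' | ⟨e, he, rfl⟩ <;> rcases hcases y hy with hy' | ⟨e', he', rfl⟩
    · rw [hFG x hx', hFG y hy']
      exact hf x hx' y hy' hne hv
    · rw [hFG x hx', hFE e' he']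
      obtain ⟨v, h1, h2⟩ := hv
      exact (hmix e' he' x hx' ⟨v, h2, h1⟩).symm
    · rw [hFG y hy', hFE e he]
      exact hmix e he y hy' hv
    · rw [hFE e he, hFE e' he']
      refine hg e he e' he' (fun h => hne (by rw [h])) ?_
      obtain ⟨v, h1, h2⟩ := hv
      rcases Sym2.mem_iff.1 h1 with h1 | h1 <;> rcases Sym2.mem_iff.1 h2 with h2 | h2
      · exact Or.inl (h1.symm.trans h2)
      · exact absurd (h1.symm.trans h2) (hbip e he e' he')
      · exact absurd (h2.symm.trans h1) (hbip e' he' e he)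
      · exact Or.inr (h1.symm.trans h2)

/-- The pairs of adjacent vertices whose first vertex has degree `d`. -/
noncomputable def pairsOfDegree {V : Type*} [Fintype V] (G : SimpleGraph V) (d : ℕ) :
    Finset (V × V) :=
  Finset.univ.filter fun e => G.Adj e.1 e.2 ∧ G.degree e.1 = d

/-- The set of vertices of degree `d`. -/
noncomputable def verticesOfDegree {V : Type*} [Fintype V] (G : SimpleGraph V) (d : ℕ) :
    Finset V :=
  Finset.univ.filter fun v => G.degree v = d

lemma mem_pairsOfDegree {V : Type*} [Fintype V] {G : SimpleGraph V} {d : ℕ} {e : V × V} :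
    e ∈ pairsOfDegree G d ↔ G.Adj e.1 e.2 ∧ G.degree e.1 = d := by
  simp [pairsOfDegree]

lemma mem_verticesOfDegree {V : Type*} [Fintype V] {G : SimpleGraph V} {d : ℕ} {v : V} :
    v ∈ verticesOfDegree G d ↔ G.degree v = d := by
  simp [verticesOfDegree]

lemma card_pairsOfDegree {V : Type*} [Fintype V] (G : SimpleGraph V) (d : ℕ) :
    (pairsOfDegree G d).card = (verticesOfDegree G d).card * d := by
  rw [Finset.card_eq_sum_card_fiberwise (f := Prod.fst) (t := verticesOfDegree G d)
    (fun e he => mem_verticesOfDegree.2 (mem_pairsOfDegree.1 he).2)]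
  apply Finset.sum_const_nat
  intro u hu
  rw [← mem_verticesOfDegree.1 hu, ← G.card_neighborFinset_eq_degree u]
  refine Finset.card_bij' (fun e _ => e.2) (fun w _ => (u, w)) ?_ ?_ ?_ ?_
  · intro e he
    obtain ⟨he, rfl⟩ := Finset.mem_filter.1 he
    simpa using (mem_pairsOfDegree.1 he).1
  · intro w hw
    refine Finset.mem_filter.2 ⟨mem_pairsOfDegree.2 ⟨by simpa using hw, ?_⟩, rfl⟩
    simp
  · intro e he
    obtain ⟨he, rfl⟩ := Finset.mem_filter.1 he
    rfl
  · intro w hw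
    rfl

lemma listEdgeColorable_of_sparse {V : Type*} [Fintype V] (G : SimpleGraph V)
    (hdeg : ∀ v, G.degree v ≤ 7)
    (hsparse : ∀ H ≤ G, H ≠ ⊥ →
      ∑ v, H.degree v < 5 * (Finset.univ.filter fun v => 0 < H.degree v).card) :
    ListEdgeColorable G 8 := by
  induction G using WellFoundedLT.induction with
  | ind G ih =>
  by_cases hG : G = ⊥
  · subst hG
    exact fun L _ => ⟨fun _ => 0, by simp, by simp⟩
  by_contra hnot
  have hred : ∀ E : Finset (V × V), E.Nonempty → (∀ e ∈ E, G.Adj e.1 e.2) →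
      (∀ e ∈ E, ∀ f ∈ E, e.1 ≠ f.2) →
      ∃ e ∈ E, 8 + min (degFst E e.1) (degSnd E e.2) < G.degree e.1 + G.degree e.2 := by
    rintro E ⟨e, he⟩ hadj hbip
    by_contra! hcon
    refine hnot (listEdgeColorable_of_deleteEdges G 8 E hadj hbip hcon ?_)
    have hle : G.deleteEdges {x | ∃ e ∈ E, s(e.1, e.2) = x} ≤ G :=
      SimpleGraph.deleteEdges_le _
    have hne : G.deleteEdges {x | ∃ e ∈ E, s(e.1, e.2) = x} ≠ G := fun heq => by
      have := hadj e he
      rw [← heq, SimpleGraph.deleteEdges_adj] at this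
      exact this.2 ⟨e, he, rfl⟩
    generalize G.deleteEdges {x | ∃ e ∈ E, s(e.1, e.2) = x} = G' at hle hne ⊢
    exact ih G' (lt_of_le_of_ne hle hne)
      (fun v => (SimpleGraph.degree_le_of_le hle).trans (hdeg v))
      fun H hH => hsparse H (hH.trans hle)
  have hedge : ∀ u w, G.Adj u w → 10 ≤ G.degree u + G.degree w := by
    intro u w huw
    obtain ⟨e, he, hlt⟩ := hred {(u, w)} (by simp) (by simpa using huw)
      (by simpa using huw.ne)
    obtain rfl := Finset.mem_singleton.1 he
    simp only [degFst, degSnd, Finset.filter_singleton, if_true, Finset.card_singleton,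
      min_self] at hlt
    omega
  have hpairs : ∀ d ≤ 4, ∀ F ⊆ pairsOfDegree G d, F.Nonempty →
      ∃ e ∈ F, G.degree e.1 = d ∧ 8 + min (degFst F e.1) (degSnd F e.2) <
        d + G.degree e.2 := by
    intro d hd F hF hne
    obtain ⟨e, he, hlt⟩ := hred F hne (fun e he => (mem_pairsOfDegree.1 (hF he)).1) (by
      intro e he f hf heq
      have h1 := mem_pairsOfDegree.1 (hF he)
      have h2 := mem_pairsOfDegree.1 (hF hf)
      have h3 := hedge _ _ h2.1
      rw [← heq] at h3
      omega)
    have := (mem_pairsOfDegree.1 (hF he)).2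
    exact ⟨e, he, this, by omega⟩
  have hfst : ∀ d, (pairsOfDegree G d).image Prod.fst ⊆ verticesOfDegree G d := by
    intro d v hv
    obtain ⟨e, he, rfl⟩ := Finset.mem_image.1 hv
    exact mem_verticesOfDegree.2 (mem_pairsOfDegree.1 he).2
  have h3 : (verticesOfDegree G 3).card * 3 ≤
      (verticesOfDegree G 3).card + (verticesOfDegree G 7).card := by
    rw [← card_pairsOfDegree]
    refine (card_le_sum_of_degenerate (fun _ => 1) (fun _ => 1) _ ?_).trans ?_
    · intro F hF hne
      obtain ⟨e, he, h1, h2⟩ := hpairs 3 (by norm_num) F hF hne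
      have := hdeg e.2
      exact ⟨e, he, by omega⟩
    · rw [← Finset.card_eq_sum_ones, ← Finset.card_eq_sum_ones]
      refine Nat.add_le_add (Finset.card_le_card (hfst 3)) (Finset.card_le_card ?_)
      intro v hv
      obtain ⟨e, he, rfl⟩ := Finset.mem_image.1 hv
      obtain ⟨h1, h2⟩ := mem_pairsOfDegree.1 he
      have := hedge _ _ h1
      have := hdeg e.2
      exact mem_verticesOfDegree.2 (by omega)
  have h4 : (verticesOfDegree G 4).card * 4 ≤ (verticesOfDegree G 4).card * 2 +
      ((verticesOfDegree G 6).card + (verticesOfDegree G 7).card * 2) := by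
    rw [← card_pairsOfDegree]
    refine (card_le_sum_of_degenerate (fun _ => 2) (fun w => G.degree w - 5) _ ?_).trans ?_
    · intro F hF hne
      obtain ⟨e, he, h1, h2⟩ := hpairs 4 le_rfl F hF hne
      have := hdeg e.2
      have := hedge _ _ (mem_pairsOfDegree.1 (hF he)).1
      exact ⟨e, he, by omega⟩
    · refine Nat.add_le_add ?_ ?_
      · rw [Finset.sum_const, smul_eq_mul]
        exact Nat.mul_le_mul_right _ (Finset.card_le_card (hfst 4))
      · have hdisj : Disjoint (verticesOfDegree G 6) (verticesOfDegree G 7) := by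
          rw [Finset.disjoint_left]
          intro v
          rw [mem_verticesOfDegree, mem_verticesOfDegree]
          omega
        calc _ ≤ ∑ w ∈ verticesOfDegree G 6 ∪ verticesOfDegree G 7, (G.degree w - 5) := by
              apply Finset.sum_le_sum_of_subset
              intro v hv
              obtain ⟨e, he, rfl⟩ := Finset.mem_image.1 hv
              obtain ⟨h1, h2⟩ := mem_pairsOfDegree.1 he
              have := hedge _ _ h1
              have := hdeg e.2
              rw [Finset.mem_union, mem_verticesOfDegree, mem_verticesOfDegree]
              omega
          _ = _ := by
              rw [Finset.sum_union hdisj]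
              congr 1
              · rw [Finset.card_eq_sum_ones]
                exact Finset.sum_congr rfl fun v hv => by rw [mem_verticesOfDegree.1 hv]
              · exact Finset.sum_const_nat fun v hv => by rw [mem_verticesOfDegree.1 hv]
  have hmin : ∀ v, 0 < G.degree v → 3 ≤ G.degree v := by
    intro v hv
    obtain ⟨w, hw⟩ := (G.degree_pos_iff_exists_adj v).1 hv
    have := hedge v w hw
    have := hdeg w
    omega
  have hcount : 5 * (Finset.univ.filter fun v => 0 < G.degree v).card +
      (verticesOfDegree G 6).card + 2 * (verticesOfDegree G 7).card ≤
      ∑ v, G.degree v + 2 * (verticesOfDegree G 3).card + (verticesOfDegree G 4).card := by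
    have hcard : ∀ d, (verticesOfDegree G d).card = ∑ v, if G.degree v = d then 1 else 0 :=
      fun d => by rw [verticesOfDegree, Finset.card_filter]
    rw [hcard, hcard, hcard, hcard, Finset.card_filter, Finset.mul_sum, Finset.mul_sum,
      Finset.mul_sum, ← Finset.sum_add_distrib, ← Finset.sum_add_distrib,
      ← Finset.sum_add_distrib, ← Finset.sum_add_distrib]
    apply Finset.sum_le_sum
    intro v _
    have h1 := hdeg v
    have h2 := hmin v
    split_ifs <;> omega
  have := hsparse G le_rfl hG
  omega

lemma MadLT.sum_degree_lt {V : Type*} [Fintype V] {G : SimpleGraph V} (hmad : MadLT G 5)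
    {H : SimpleGraph V} (hH : H ≤ G) (hne : H ≠ ⊥) :
    ∑ v, H.degree v < 5 * (Finset.univ.filter fun v => 0 < H.degree v).card := by
  let S : G.Subgraph :=
    { verts := {v | 0 < H.degree v}
      Adj := H.Adj
      adj_sub := fun h => hH h
      edge_vert := fun {v w} h => (H.degree_pos_iff_exists_adj v).2 ⟨w, h⟩
      symm := H.symm }
  obtain ⟨a, b, hab⟩ := SimpleGraph.ne_bot_iff_exists_adj.1 hne
  have hnonempty : S.verts.Nonempty := ⟨a, (H.degree_pos_iff_exists_adj a).2 ⟨b, hab⟩⟩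
  have hncard : ∀ v, ((S.neighborSet v).ncard : ℝ) = H.degree v := by
    intro v
    rw [← H.card_neighborFinset_eq_degree v, ← Set.ncard_coe_finset, H.coe_neighborFinset]
    rfl
  have h : (∑ v ∈ Finset.univ.filter (fun v => 0 < H.degree v), ((S.neighborSet v).ncard : ℝ)) /
      ((Finset.univ.filter fun v => 0 < H.degree v).card : ℝ) < 5 := by
    convert hmad S hnonempty <;> (ext v; simp [S])
  have hpos : (0 : ℝ) < (Finset.univ.filter fun v => 0 < H.degree v).card := by
    exact_mod_cast Finset.card_pos.2
      ⟨a, Finset.mem_filter.2 ⟨Finset.mem_univ a, (H.degree_pos_iff_exists_adj a).2 ⟨b, hab⟩⟩⟩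
  rw [Finset.sum_congr rfl fun v _ => hncard v, div_lt_iff₀ hpos] at h
  have hsum : ∑ v ∈ Finset.univ.filter (fun v => 0 < H.degree v), H.degree v =
      ∑ v, H.degree v := by
    rw [Finset.sum_filter]
    refine Finset.sum_congr rfl fun v _ => ?_
    split_ifs with hv
    · rfl
    · omega
  rw [← hsum]
  exact_mod_cast h

theorem stmt_9 {V : Type*} [Fintype V] (G : SimpleGraph V) [DecidableRel G.Adj]
    (hΔ : G.maxDegree = 7) (hmad : MadLT G 5) :
    listChromaticIndex G ≤ 8 := by
  refine Nat.sInf_le (listEdgeColorable_of_sparse G (fun v => ?_) fun H hH hne =>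
    hmad.sum_degree_lt hH hne)
  have := G.degree_le_maxDegree v
  rw [hΔ] at this
  convert this
end

section
/- If G is a finite simple graph with maximum degree Δ ≥ 9 and mad(G) < 6, then χ'_ℓ(G) ≤ Δ + 1. -/
open scoped Classical

section BipartiteListColoring

variable {ε α β : Type*}

/-- A stable matching exists in a finite bipartite multigraph with edge set `E` and end maps
`a`, `b`, the edges at each vertex being strictly ranked by `p` and `q`. -/
theorem exists_stable_matching (a : ε → α) (b : ε → β) (p q : ε → ℤ) (E : Finset ε)
    (hp : ∀ e ∈ E, ∀ f ∈ E, a e = a f → p e = p f → e = f)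
    (hq : ∀ e ∈ E, ∀ f ∈ E, b e = b f → q e = q f → e = f) :
    ∃ M ⊆ E, (∀ e ∈ M, ∀ f ∈ M, e ≠ f → a e ≠ a f ∧ b e ≠ b f) ∧
      ∀ e ∈ E, e ∉ M → ∃ f ∈ M, (a f = a e ∧ p e < p f) ∨ (b f = b e ∧ q e < q f) := by
  induction E using Finset.strongInduction with
  | H E ih =>
  by_cases hT : ∃ f ∈ E, ∃ g ∈ E, b f = b g ∧ q g < q f ∧ ∀ h ∈ E, a h = a f → p h ≤ p f
  · obtain ⟨f, hf, g, hg, hb, hlt, hmax⟩ := hT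
    obtain ⟨M, hME, hM, hS⟩ := ih (E.erase g) (Finset.erase_ssubset hg)
      (fun e he f hf => hp e (Finset.mem_of_mem_erase he) f (Finset.mem_of_mem_erase hf))
      (fun e he f hf => hq e (Finset.mem_of_mem_erase he) f (Finset.mem_of_mem_erase hf))
    refine ⟨M, hME.trans (Finset.erase_subset _ _), hM, fun e he heM => ?_⟩
    by_cases heg : e = g
    · subst heg
      have hfe : f ≠ e := by rintro rfl; exact lt_irrefl _ hlt
      by_cases hfM : f ∈ M
      · exact ⟨f, hfM, Or.inr ⟨hb, hlt⟩⟩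
      · obtain ⟨h, hhM, hh⟩ := hS f (Finset.mem_erase.2 ⟨hfe, hf⟩) hfM
        rcases hh with ⟨h1, h2⟩ | ⟨h1, h2⟩
        · exact absurd (hmax h (Finset.mem_of_mem_erase (hME hhM)) h1) (not_le.2 h2)
        · exact ⟨h, hhM, Or.inr ⟨h1.trans hb, hlt.trans h2⟩⟩
    · exact hS e (Finset.mem_erase.2 ⟨heg, he⟩) heM
  · push Not at hT
    refine ⟨E.filter fun f => ∀ h ∈ E, a h = a f → p h ≤ p f, Finset.filter_subset _ _, ?_, ?_⟩
    · intro e he f hf hef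
      rw [Finset.mem_filter] at he hf
      refine ⟨fun h => hef (hp e he.1 f hf.1 h
        (le_antisymm (hf.2 e he.1 h) (he.2 f hf.1 h.symm))), fun h => ?_⟩
      rcases lt_trichotomy (q e) (q f) with hlt | heq | hlt
      · obtain ⟨x, hx, hxa, hxp⟩ := hT f hf.1 e he.1 h.symm hlt
        exact absurd (hf.2 x hx hxa) (not_le.2 hxp)
      · exact hef (hq e he.1 f hf.1 h heq)
      · obtain ⟨x, hx, hxa, hxp⟩ := hT e he.1 f hf.1 h hlt
        exact absurd (he.2 x hx hxa) (not_le.2 hxp)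
    · intro e he heM
      obtain ⟨f, hf, hmax⟩ := Finset.exists_max_image (E.filter fun f => a f = a e) p
        ⟨e, Finset.mem_filter.2 ⟨he, rfl⟩⟩
      rw [Finset.mem_filter] at hf
      have hfM : f ∈ E.filter fun f => ∀ h ∈ E, a h = a f → p h ≤ p f :=
        Finset.mem_filter.2 ⟨hf.1, fun h hh hhf =>
          hmax h (Finset.mem_filter.2 ⟨hh, hhf.trans hf.2⟩)⟩
      refine ⟨f, hfM, Or.inl ⟨hf.2, lt_of_le_of_ne (hmax e (Finset.mem_filter.2 ⟨he, rfl⟩)) ?_⟩⟩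
      intro heq
      exact heM (hp e he f hf.1 hf.2.symm heq ▸ hfM)

/-- Galvin's kernel method: a bipartite multigraph is edge-colorable from lists that are larger
than the number of higher-ranked adjacent edges. -/
theorem exists_list_coloring_of_ranking (a : ε → α) (b : ε → β) (p q : ε → ℤ) (E : Finset ε)
    (L : ε → Finset ℕ)
    (hp : ∀ e ∈ E, ∀ f ∈ E, a e = a f → p e = p f → e = f)
    (hq : ∀ e ∈ E, ∀ f ∈ E, b e = b f → q e = q f → e = f)
    (hL : ∀ e ∈ E, (E.filter fun f => a f = a e ∧ p e < p f).card +
      (E.filter fun f => b f = b e ∧ q e < q f).card < (L e).card) :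
    ∃ c : ε → ℕ, (∀ e ∈ E, c e ∈ L e) ∧
      ∀ e ∈ E, ∀ f ∈ E, e ≠ f → (a e = a f ∨ b e = b f) → c e ≠ c f := by
  induction E using Finset.strongInduction generalizing L with
  | H E ih =>
  obtain rfl | ⟨e₀, he₀⟩ := E.eq_empty_or_nonempty
  · exact ⟨fun _ => 0, by simp, by simp⟩
  obtain ⟨x, hx⟩ : (L e₀).Nonempty := Finset.card_pos.1 (lt_of_le_of_lt (Nat.zero_le _) (hL e₀ he₀))
  obtain ⟨M, hME, hM, hS⟩ := exists_stable_matching a b p q (E.filter fun e => x ∈ L e)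
    (fun e he f hf => hp e (Finset.mem_filter.1 he).1 f (Finset.mem_filter.1 hf).1)
    (fun e he f hf => hq e (Finset.mem_filter.1 he).1 f (Finset.mem_filter.1 hf).1)
  have hME' : M ⊆ E := hME.trans (Finset.filter_subset _ _)
  have hMne : M.Nonempty := by
    by_cases h : e₀ ∈ M
    · exact ⟨_, h⟩
    · obtain ⟨f, hf, -⟩ := hS e₀ (Finset.mem_filter.2 ⟨he₀, hx⟩) h
      exact ⟨f, hf⟩
  obtain ⟨c, hc, hcp⟩ := ih (E \ M) (Finset.sdiff_ssubset hME' hMne) (fun e => (L e).erase x)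
    (fun e he f hf => hp e (Finset.mem_sdiff.1 he).1 f (Finset.mem_sdiff.1 hf).1)
    (fun e he f hf => hq e (Finset.mem_sdiff.1 he).1 f (Finset.mem_sdiff.1 hf).1) (by
      intro e he
      obtain ⟨heE, heM⟩ := Finset.mem_sdiff.1 he
      have h1 : ((E \ M).filter fun f => a f = a e ∧ p e < p f) ⊆
          E.filter fun f => a f = a e ∧ p e < p f :=
        Finset.filter_subset_filter _ Finset.sdiff_subset
      have h2 : ((E \ M).filter fun f => b f = b e ∧ q e < q f) ⊆
          E.filter fun f => b f = b e ∧ q e < q f :=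
        Finset.filter_subset_filter _ Finset.sdiff_subset
      have h1' := Finset.card_le_card h1
      have h2' := Finset.card_le_card h2
      have h3 := hL e heE
      by_cases hxe : x ∈ L e
      · have h4 := Finset.card_erase_of_mem hxe
        obtain ⟨f, hf, hfe⟩ := hS e (Finset.mem_filter.2 ⟨heE, hxe⟩) heM
        rcases hfe with hfe | hfe
        · have : ((E \ M).filter fun f => a f = a e ∧ p e < p f).card <
              (E.filter fun f => a f = a e ∧ p e < p f).card := by
            refine Finset.card_lt_card ((Finset.ssubset_iff_of_subset h1).2 ⟨f, ?_, ?_⟩)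
            · exact Finset.mem_filter.2 ⟨hME' hf, hfe⟩
            · simp [hf]
          omega
        · have : ((E \ M).filter fun f => b f = b e ∧ q e < q f).card <
              (E.filter fun f => b f = b e ∧ q e < q f).card := by
            refine Finset.card_lt_card ((Finset.ssubset_iff_of_subset h2).2 ⟨f, ?_, ?_⟩)
            · exact Finset.mem_filter.2 ⟨hME' hf, hfe⟩
            · simp [hf]
          omega
      · rw [Finset.erase_eq_of_notMem hxe]
        omega)
  refine ⟨fun e => if e ∈ M then x else c e, fun e he => ?_, fun e he f hf hef hab => ?_⟩
  · by_cases h : e ∈ M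
    · simpa [h] using (Finset.mem_filter.1 (hME h)).2
    · simpa [h] using Finset.mem_of_mem_erase (hc e (Finset.mem_sdiff.2 ⟨he, h⟩))
  · by_cases h : e ∈ M <;> by_cases hfM : f ∈ M
    · have := hM e h f hfM hef
      tauto
    · simpa [h, hfM] using (Finset.ne_of_mem_erase (hc f (Finset.mem_sdiff.2 ⟨hf, hfM⟩))).symm
    · simpa [h, hfM] using Finset.ne_of_mem_erase (hc e (Finset.mem_sdiff.2 ⟨he, h⟩))
    · simpa [h, hfM] using hcp e (Finset.mem_sdiff.2 ⟨he, h⟩) f (Finset.mem_sdiff.2 ⟨hf, hfM⟩) hef hab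

/-- If there are at least as many `a`-ends as `b`-ends, some nonempty matching covers every
`b`-neighbor of a matched `a`-end whose degree is at least that of the `a`-end. -/
theorem exists_matching_covering_large_neighbors (a : ε → α) (b : ε → β) (E : Finset ε)
    (hE : E.Nonempty) (hab : (E.image b).card ≤ (E.image a).card) :
    ∃ M ⊆ E, M.Nonempty ∧ (∀ e ∈ M, ∀ f ∈ M, e ≠ f → a e ≠ a f ∧ b e ≠ b f) ∧
      ∀ e ∈ E, ∀ m ∈ M, a m = a e →
        (E.filter fun f => a f = a e).card ≤ (E.filter fun f => b f = b e).card →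
        ∃ m' ∈ M, b m' = b e := by
  set K := E.filter fun e =>
    (E.filter fun f => a f = a e).card ≤ (E.filter fun f => b f = b e).card with hK
  let N : Finset α → Finset β := fun S => (K.filter fun e => a e ∈ S).image b
  have hNmono : ∀ S T, S ⊆ T → N S ⊆ N T := fun S T h =>
    Finset.image_subset_image fun e he => by
      rw [Finset.mem_filter] at he ⊢
      exact ⟨he.1, h he.2⟩
  obtain ⟨S, hSmin⟩ := ((E.image a).powerset.filter
      fun S => S.Nonempty ∧ (N S).card ≤ S.card).exists_minimal
    ⟨E.image a, by
      rw [Finset.mem_filter]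
      refine ⟨by simp, hE.image a, le_trans (Finset.card_le_card ?_) hab⟩
      exact Finset.image_subset_image
        ((Finset.filter_subset _ _).trans (Finset.filter_subset _ _))⟩
  have hS := hSmin.prop
  rw [Finset.mem_filter, Finset.mem_powerset] at hS
  obtain ⟨hSE, hSne, hNS⟩ := hS
  have hmin : ∀ T ⊆ S, T.Nonempty → (N T).card ≤ T.card → T = S := fun T hT hTne hNT =>
    hSmin.eq_of_le (Finset.mem_filter.2 ⟨Finset.mem_powerset.2 (hT.trans hSE), hTne, hNT⟩) hT
  obtain hN | hN := (N S).eq_empty_or_nonempty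
  · obtain ⟨s, hs⟩ := hSne
    obtain ⟨e₀, he₀, rfl⟩ := Finset.mem_image.1 (hSE hs)
    refine ⟨{e₀}, by simpa using he₀, by simp, by simp, ?_⟩
    intro e he m hm hme hle
    rw [Finset.mem_singleton] at hm
    subst hm
    have : b e ∈ N S := Finset.mem_image_of_mem b
      (Finset.mem_filter.2 ⟨Finset.mem_filter.2 ⟨he, hle⟩, hme ▸ hs⟩)
    simp [hN] at this
  · have hall : ∀ T ⊆ S, T.card ≤ (N T).card := by
      intro T hT
      obtain rfl | hTne := T.eq_empty_or_nonempty
      · simp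
      by_contra hlt
      push Not at hlt
      obtain rfl := hmin T hT hTne hlt.le
      obtain ⟨s, hs⟩ := hTne
      have h1 := Finset.card_erase_of_mem hs
      have h2 := Finset.card_pos.2 hN
      have h3 := Finset.card_le_card (hNmono _ _ (Finset.erase_subset s T))
      have h4 := hmin (T.erase s) (Finset.erase_subset _ _)
        (Finset.card_pos.1 (by omega)) (by omega)
      exact Finset.notMem_erase s T (h4.symm.subset hs)
    obtain ⟨g, hginj, hg⟩ := (Finset.all_card_le_biUnion_card_iff_exists_injective
      (fun s : S => (K.filter fun e => a e = s).image b)).1 (by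
        intro T
        have h := hall (T.map (Function.Embedding.subtype _)) (by
          intro x hx
          simp only [Finset.mem_map, Function.Embedding.subtype_apply] at hx
          obtain ⟨y, -, rfl⟩ := hx
          exact y.2)
        rw [Finset.card_map] at h
        refine h.trans (Finset.card_le_card ?_)
        intro y hy
        obtain ⟨e, he, rfl⟩ := Finset.mem_image.1 hy
        obtain ⟨heK, heT⟩ := Finset.mem_filter.1 he
        obtain ⟨s, hsT, hs⟩ := Finset.mem_map.1 heT
        exact Finset.mem_biUnion.2 ⟨s, hsT, Finset.mem_image_of_mem b
          (Finset.mem_filter.2 ⟨heK, hs.symm⟩)⟩)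
    have hch : ∀ s : S, ∃ e ∈ K, a e = s ∧ b e = g s := fun s => by
      obtain ⟨e, he, hbe⟩ := Finset.mem_image.1 (hg s)
      obtain ⟨heK, hae⟩ := Finset.mem_filter.1 he
      exact ⟨e, heK, hae, hbe⟩
    choose m hmK hma hmb using hch
    have himg : Finset.univ.image g = N S := by
      refine Finset.eq_of_subset_of_card_le ?_ ?_
      · intro y hy
        obtain ⟨s, -, rfl⟩ := Finset.mem_image.1 hy
        rw [← hmb s]
        exact Finset.mem_image_of_mem b (Finset.mem_filter.2 ⟨hmK s, by rw [hma]; exact s.2⟩)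
      · rw [Finset.card_image_of_injective _ hginj]
        simpa using hNS
    refine ⟨Finset.univ.image m, ?_, ?_, ?_, ?_⟩
    · intro e he
      obtain ⟨s, -, rfl⟩ := Finset.mem_image.1 he
      exact (Finset.mem_filter.1 (hmK s)).1
    · obtain ⟨s, hs⟩ := hSne
      exact ⟨m ⟨s, hs⟩, Finset.mem_image_of_mem m (Finset.mem_univ _)⟩
    · intro e he f hf hef
      obtain ⟨s, -, rfl⟩ := Finset.mem_image.1 he
      obtain ⟨t, -, rfl⟩ := Finset.mem_image.1 hf
      have hst : s ≠ t := fun h => hef (congrArg m h)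
      rw [hma, hma, hmb, hmb]
      exact ⟨fun h => hst (Subtype.ext h), fun h => hst (hginj h)⟩
    · intro e he f hf hfe hle
      obtain ⟨s, -, rfl⟩ := Finset.mem_image.1 hf
      have : b e ∈ N S := Finset.mem_image_of_mem b
        (Finset.mem_filter.2 ⟨Finset.mem_filter.2 ⟨he, hle⟩, by rw [← hfe, hma]; exact s.2⟩)
      rw [← himg] at this
      obtain ⟨t, -, ht⟩ := Finset.mem_image.1 this
      exact ⟨m t, Finset.mem_image_of_mem m (Finset.mem_univ _), (hmb t).trans ht⟩

/-- Extends a ranking of `E \ M` to `E` by putting the matching edges on top at their `a`-ends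
and at the bottom at their `b`-ends. -/
theorem exists_ranking_of_sdiff_matching (a : ε → α) (b : ε → β) (E M : Finset ε) (hME : M ⊆ E)
    (hM : ∀ e ∈ M, ∀ f ∈ M, e ≠ f → a e ≠ a f ∧ b e ≠ b f)
    (hcov : ∀ e ∈ E, ∀ m ∈ M, a m = a e →
        (E.filter fun f => a f = a e).card ≤ (E.filter fun f => b f = b e).card →
        ∃ m' ∈ M, b m' = b e)
    (ih : ∃ p q : ε → ℤ,
      (∀ e ∈ E \ M, ∀ f ∈ E \ M, a e = a f → p e = p f → e = f) ∧
      (∀ e ∈ E \ M, ∀ f ∈ E \ M, b e = b f → q e = q f → e = f) ∧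
      ∀ e ∈ E \ M, ((E \ M).filter fun f => a f = a e ∧ p e < p f).card +
        ((E \ M).filter fun f => b f = b e ∧ q e < q f).card <
        max ((E \ M).filter fun f => a f = a e).card ((E \ M).filter fun f => b f = b e).card) :
    ∃ p q : ε → ℤ,
      (∀ e ∈ E, ∀ f ∈ E, a e = a f → p e = p f → e = f) ∧
      (∀ e ∈ E, ∀ f ∈ E, b e = b f → q e = q f → e = f) ∧
      ∀ e ∈ E, (E.filter fun f => a f = a e ∧ p e < p f).card +
        (E.filter fun f => b f = b e ∧ q e < q f).card <
        max (E.filter fun f => a f = a e).card (E.filter fun f => b f = b e).card := by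
  obtain ⟨p, q, hp, hq, hpq⟩ := ih
  obtain ⟨P, hP⟩ := (E.image p).bddAbove
  obtain ⟨Q, hQ⟩ := (E.image q).bddBelow
  have hP' : ∀ e ∈ E, p e < P + 1 := fun e he =>
    Int.lt_add_one_of_le (hP (by exact_mod_cast Finset.mem_image_of_mem p he))
  have hQ' : ∀ e ∈ E, Q - 1 < q e := fun e he =>
    Int.sub_one_lt_of_le (hQ (by exact_mod_cast Finset.mem_image_of_mem q he))
  refine ⟨fun e => if e ∈ M then P + 1 else p e, fun e => if e ∈ M then Q - 1 else q e, ?_, ?_, ?_⟩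
  · intro e he f hf hef h
    have h1 := hP' e he
    have h2 := hP' f hf
    by_cases heM : e ∈ M <;> by_cases hfM : f ∈ M <;> simp only [heM, hfM, if_true, if_false] at h
    · by_contra hne
      exact (hM e heM f hfM hne).1 hef
    · omega
    · omega
    · exact hp e (by simp [*]) f (by simp [*]) hef h
  · intro e he f hf hef h
    have h1 := hQ' e he
    have h2 := hQ' f hf
    by_cases heM : e ∈ M <;> by_cases hfM : f ∈ M <;> simp only [heM, hfM, if_true, if_false] at h
    · by_contra hne
      exact (hM e heM f hfM hne).2 hef
    · omega
    · omega
    · exact hq e (by simp [*]) f (by simp [*]) hef h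
  · intro e he
    by_cases heM : e ∈ M
    · have h1 : (E.filter fun f => a f = a e ∧
          (if e ∈ M then P + 1 else p e) < (if f ∈ M then P + 1 else p f)) = ∅ := by
        refine Finset.filter_eq_empty_iff.2 fun f hf h => ?_
        have := hP' f hf
        have h' := h.2
        by_cases hfM : f ∈ M <;> simp only [heM, hfM, if_true, if_false] at h' <;> omega
      have h2 : (E.filter fun f => b f = b e ∧
          (if e ∈ M then Q - 1 else q e) < (if f ∈ M then Q - 1 else q f)).card <
          (E.filter fun f => b f = b e).card := by
        refine Finset.card_lt_card ((Finset.ssubset_iff_of_subset ?_).2 ⟨e, ?_, ?_⟩)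
        · exact Finset.monotone_filter_right _ fun f _ h => h.1
        · simp [he]
        · simp
      simp only [h1, Finset.card_empty]
      omega
    · have he' : e ∈ E \ M := Finset.mem_sdiff.2 ⟨he, heM⟩
      have key := hpq e he'
      have hb : (E.filter fun f => b f = b e ∧
          (if e ∈ M then Q - 1 else q e) < (if f ∈ M then Q - 1 else q f)) =
          (E \ M).filter fun f => b f = b e ∧ q e < q f := by
        ext f
        have := hQ' e he
        by_cases hfM : f ∈ M <;> simp only [Finset.mem_filter, Finset.mem_sdiff, heM, hfM, if_true,
          if_false, not_true_eq_false, not_false_eq_true, and_false, false_and, and_true,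
          iff_false, not_and]
        intros
        omega
      have hda : ((E \ M).filter fun f => a f = a e) ⊆ E.filter fun f => a f = a e :=
        Finset.filter_subset_filter _ Finset.sdiff_subset
      have hdb : ((E \ M).filter fun f => b f = b e) ⊆ E.filter fun f => b f = b e :=
        Finset.filter_subset_filter _ Finset.sdiff_subset
      have hda' := Finset.card_le_card hda
      have hdb' := Finset.card_le_card hdb
      simp only [hb]
      by_cases hm : ∃ m ∈ M, a m = a e
      · obtain ⟨m, hmM, hme⟩ := hm
        have ha : (E.filter fun f => a f = a e ∧
            (if e ∈ M then P + 1 else p e) < (if f ∈ M then P + 1 else p f)).card ≤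
            ((E \ M).filter fun f => a f = a e ∧ p e < p f).card + 1 := by
          rw [← Finset.card_insert_of_notMem (a := m) (by simp [hmM])]
          refine Finset.card_le_card fun f hf => ?_
          rw [Finset.mem_filter] at hf
          rw [Finset.mem_insert, Finset.mem_filter, Finset.mem_sdiff]
          by_cases hfM : f ∈ M
          · left
            by_contra hne
            exact (hM f hfM m hmM hne).1 (hf.2.1.trans hme.symm)
          · right
            have h' := hf.2.2
            simp only [heM, hfM, if_false] at h'
            exact ⟨⟨hf.1, hfM⟩, hf.2.1, h'⟩
        have hlt : ((E \ M).filter fun f => a f = a e).card < (E.filter fun f => a f = a e).card :=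
          Finset.card_lt_card ((Finset.ssubset_iff_of_subset hda).2
            ⟨m, Finset.mem_filter.2 ⟨hME hmM, hme⟩, by simp [hmM]⟩)
        by_cases hle : (E.filter fun f => a f = a e).card ≤ (E.filter fun f => b f = b e).card
        · obtain ⟨m', hm', hbm⟩ := hcov e he m hmM hme hle
          have hlt' : ((E \ M).filter fun f => b f = b e).card <
              (E.filter fun f => b f = b e).card :=
            Finset.card_lt_card ((Finset.ssubset_iff_of_subset hdb).2
              ⟨m', Finset.mem_filter.2 ⟨hME hm', hbm⟩, by simp [hm']⟩)
          omega
        · omega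
      · have ha : (E.filter fun f => a f = a e ∧
            (if e ∈ M then P + 1 else p e) < (if f ∈ M then P + 1 else p f)) ⊆
            (E \ M).filter fun f => a f = a e ∧ p e < p f := by
          intro f hf
          rw [Finset.mem_filter] at hf
          have hfM : f ∉ M := fun h => hm ⟨f, h, hf.2.1⟩
          have h' := hf.2.2
          simp only [heM, hfM, if_false] at h'
          exact Finset.mem_filter.2 ⟨Finset.mem_sdiff.2 ⟨hf.1, hfM⟩, hf.2.1, h'⟩
        have := Finset.card_le_card ha
        omega

/-- The edges at each vertex of a bipartite multigraph can be ranked so that every edge has fewer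
higher-ranked adjacent edges than the larger of the degrees of its two ends. -/
theorem exists_ranking_lt_max_degree (a : ε → α) (b : ε → β) (E : Finset ε) :
    ∃ p q : ε → ℤ,
      (∀ e ∈ E, ∀ f ∈ E, a e = a f → p e = p f → e = f) ∧
      (∀ e ∈ E, ∀ f ∈ E, b e = b f → q e = q f → e = f) ∧
      ∀ e ∈ E, (E.filter fun f => a f = a e ∧ p e < p f).card +
        (E.filter fun f => b f = b e ∧ q e < q f).card <
        max (E.filter fun f => a f = a e).card (E.filter fun f => b f = b e).card := by
  induction E using Finset.strongInduction with
  | H E ih =>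
  obtain rfl | hE := E.eq_empty_or_nonempty
  · exact ⟨0, 0, by simp, by simp, by simp⟩
  rcases le_total (E.image b).card (E.image a).card with h | h
  · obtain ⟨M, hME, hMne, hM, hcov⟩ := exists_matching_covering_large_neighbors a b E hE h
    exact exists_ranking_of_sdiff_matching a b E M hME hM hcov
      (ih _ (Finset.sdiff_ssubset hME hMne))
  · obtain ⟨M, hME, hMne, hM, hcov⟩ := exists_matching_covering_large_neighbors b a E hE h
    obtain ⟨p, q, hp, hq, hpq⟩ := ih _ (Finset.sdiff_ssubset hME hMne)
    obtain ⟨q', p', hq', hp', hpq'⟩ := exists_ranking_of_sdiff_matching b a E M hME hM hcov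
      ⟨q, p, hq, hp, fun e he => by rw [add_comm, max_comm]; exact hpq e he⟩
    exact ⟨p', q', hp', hq', fun e he => by rw [add_comm, max_comm]; exact hpq' e he⟩

/-- The Borodin–Kostochka–Woodall theorem: a bipartite multigraph is edge-colorable from lists
that are at least as large as the degrees of both ends of each edge. -/
theorem exists_list_coloring_of_degree_le (a : ε → α) (b : ε → β) (E : Finset ε)
    (L : ε → Finset ℕ)
    (ha : ∀ e ∈ E, (E.filter fun f => a f = a e).card ≤ (L e).card)
    (hb : ∀ e ∈ E, (E.filter fun f => b f = b e).card ≤ (L e).card) :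
    ∃ c : ε → ℕ, (∀ e ∈ E, c e ∈ L e) ∧
      ∀ e ∈ E, ∀ f ∈ E, e ≠ f → (a e = a f ∨ b e = b f) → c e ≠ c f := by
  obtain ⟨p, q, hp, hq, hpq⟩ := exists_ranking_lt_max_degree a b E
  exact exists_list_coloring_of_ranking a b p q E L hp hq fun e he =>
    (hpq e he).trans_le (max_le (ha e he) (hb e he))

end BipartiteListColoring

section Discharging

/-- If every nonempty set of edges contains an edge with an end whose degree within the set is
small, then peeling off such edges splits them into a part `H \ D` that is sparse at the `a`-ends
and a part `D` that is sparse at the `b`-ends. -/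
theorem exists_sparse_splitting {ε α β : Type*} (a : ε → α) (b : ε → β) (dA : α → ℕ) (dB : β → ℕ)
    (Δ : ℕ) (hdB : ∀ v, dB v ≤ Δ) (H : Finset ε)
    (hH : ∀ K ⊆ H, K.Nonempty → ∃ e ∈ K,
      (K.filter fun f => a f = a e).card + Δ + 1 < dA (a e) + dB (b e) ∨
      (K.filter fun f => b f = b e).card + Δ + 1 < dA (a e) + dB (b e)) :
    ∃ D ⊆ H, (∀ u, ((H \ D).filter fun e => a e = u).card ≤ dA u - 2) ∧
      ∀ v i, (D.filter fun e => b e = v ∧ dA (a e) ≤ i).card ≤ i + dB v - (Δ + 2) := by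
  induction H using Finset.strongInduction with
  | H H ih =>
  obtain rfl | hne := H.eq_empty_or_nonempty
  · exact ⟨∅, by simp, by simp, by simp⟩
  obtain ⟨e, he, hlow⟩ := hH H subset_rfl hne
  obtain ⟨D, hDH, hA, hB⟩ := ih (H.erase e) (Finset.erase_ssubset he)
    fun K hK => hH K (hK.trans (Finset.erase_subset _ _))
  have heD : e ∉ D := fun h => Finset.notMem_erase e H (hDH h)
  have hDH' : D ⊆ H := hDH.trans (Finset.erase_subset _ _)
  have hdBe := hdB (b e)
  rcases hlow with hlow | hlow
  · refine ⟨D, hDH', fun u => ?_, hB⟩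
    by_cases hu : a e = u
    · subst hu
      have : ((H \ D).filter fun f => a f = a e).card ≤ (H.filter fun f => a f = a e).card :=
        Finset.card_le_card (Finset.filter_subset_filter _ Finset.sdiff_subset)
      omega
    · refine le_trans (Finset.card_le_card fun f hf => ?_) (hA u)
      simp only [Finset.mem_filter, Finset.mem_sdiff, Finset.mem_erase] at hf ⊢
      exact ⟨⟨⟨fun h => hu (h ▸ hf.2), hf.1.1⟩, hf.1.2⟩, hf.2⟩
  · refine ⟨insert e D, Finset.insert_subset he hDH', fun u => ?_, fun v i => ?_⟩
    · refine le_trans (Finset.card_le_card fun f hf => ?_) (hA u)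
      simp only [Finset.mem_filter, Finset.mem_sdiff, Finset.mem_insert, Finset.mem_erase] at hf ⊢
      tauto
    · by_cases hv : b e = v ∧ dA (a e) ≤ i
      · obtain ⟨rfl, hi⟩ := hv
        have : ((insert e D).filter fun f => b f = b e ∧ dA (a f) ≤ i).card ≤
            (H.filter fun f => b f = b e).card := by
          refine Finset.card_le_card fun f hf => ?_
          rw [Finset.mem_filter] at hf ⊢
          exact ⟨Finset.insert_subset he hDH' hf.1, hf.2.1⟩
        omega
      · rw [Finset.filter_insert, if_neg hv]
        exact hB v i

variable {V : Type*} [Fintype V]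

/-- In a nonempty graph of maximum degree at most `Δ`, where `Δ ≥ 9`, and average degree (over its
non-isolated vertices) below `6`, there is a nonempty bipartite set `H` of edges in which both ends
of every edge `uv` have degree at least `d(u) + d(v) - Δ - 1`. -/
theorem exists_reducible_bipartite (F : SimpleGraph V) (Δ : ℕ) (hΔ : ∀ v, F.degree v ≤ Δ)
    (hΔ9 : 9 ≤ Δ)
    (hsum : ∑ v ∈ Finset.univ.filter (fun v => 0 < F.degree v), ((F.degree v : ℤ) - 6) < 0) :
    ∃ H : Finset (V × V), H.Nonempty ∧ (∀ e ∈ H, F.Adj e.1 e.2) ∧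
      (∀ e ∈ H, ∀ f ∈ H, e.1 ≠ f.2) ∧
      ∀ e ∈ H, F.degree e.1 + F.degree e.2 ≤ (H.filter fun f => f.1 = e.1).card + Δ + 1 ∧
        F.degree e.1 + F.degree e.2 ≤ (H.filter fun f => f.2 = e.2).card + Δ + 1 := by
  by_contra hno
  push Not at hno
  have hadj : ∀ u v, F.Adj u v → Δ + 3 ≤ F.degree u + F.degree v := by
    intro u v huv
    by_contra hlt
    obtain ⟨e, he, h⟩ := hno {(u, v)} (by simp) (by simpa using huv) (by simpa using huv.ne)
    rw [Finset.mem_singleton] at he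
    subst he
    simp only [Finset.filter_singleton, if_true, Finset.card_singleton] at h
    omega
  set B := Finset.univ.filter fun e : V × V => F.Adj e.1 e.2 ∧ F.degree e.1 ≤ 5 with hBdef
  have hB : ∀ e ∈ B, F.Adj e.1 e.2 ∧ F.degree e.1 ≤ 5 ∧ 3 ≤ F.degree e.1 ∧
      6 ≤ F.degree e.2 := by
    intro e he
    obtain ⟨-, h1, h2⟩ := Finset.mem_filter.1 he
    have := hadj _ _ h1
    have := hΔ e.1
    have := hΔ e.2
    exact ⟨h1, h2, by omega, by omega⟩
  obtain ⟨D, hDB, hA, hD⟩ := exists_sparse_splitting Prod.fst Prod.snd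
    (fun v => F.degree v) (fun v => F.degree v) Δ hΔ B (by
      intro K hK hKne
      obtain ⟨e, he, h⟩ := hno K hKne (fun e he => (hB e (hK he)).1) (by
        intro e he f hf hef
        have h1 := (hB e (hK he)).2.1
        have h2 := (hB f (hK hf)).2.2.2
        rw [hef] at h1
        omega)
      refine ⟨e, he, ?_⟩
      by_cases h' : F.degree e.1 + F.degree e.2 ≤ (K.filter fun f => f.1 = e.1).card + Δ + 1
      · exact Or.inr (h h')
      · exact Or.inl (not_le.1 h'))
  set W := Finset.univ.filter fun v => 0 < F.degree v with hW
  have hW3 : ∀ v ∈ W, 3 ≤ F.degree v := by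
    intro v hv
    obtain ⟨w, hw⟩ := (F.degree_pos_iff_exists_adj v).1 (Finset.mem_filter.1 hv).2
    have := hadj _ _ hw
    have := hΔ w
    omega
  have hsmall : ∀ u ∈ W, F.degree u ≤ 5 → 2 ≤ (D.filter fun e => e.1 = u).card := by
    intro u hu hu5
    have h1 : (B.filter fun e => e.1 = u).card = F.degree u := by
      rw [← F.card_neighborFinset_eq_degree]
      refine Finset.card_bij (fun e _ => e.2) ?_ ?_ ?_
      · intro e he
        obtain ⟨heB, heu⟩ := Finset.mem_filter.1 he
        rw [SimpleGraph.mem_neighborFinset, ← heu]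
        exact (hB e heB).1
      · intro e he f hf hef
        exact Prod.ext ((Finset.mem_filter.1 he).2.trans (Finset.mem_filter.1 hf).2.symm) hef
      · intro w hw
        exact ⟨(u, w), by simpa [hBdef, hu5] using hw, rfl⟩
    have h2 : (B.filter fun e => e.1 = u).card ≤
        ((B \ D).filter fun e => e.1 = u).card + (D.filter fun e => e.1 = u).card := by
      refine le_trans (Finset.card_le_card fun e he => ?_) (Finset.card_union_le _ _)
      simp only [Finset.mem_filter, Finset.mem_union, Finset.mem_sdiff] at he ⊢
      tauto
    have h3 : ((B \ D).filter fun e => e.1 = u).card ≤ F.degree u - 2 := by convert hA u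
    have h4 := hW3 u hu
    omega
  have hbig : ∀ v, 6 ≤ F.degree v →
      ∑ e ∈ D.filter (fun e => e.2 = v), (6 - (F.degree e.1 : ℤ)) ≤ 2 * (F.degree v - 6) := by
    intro v hv
    have h1 : ∑ e ∈ D.filter (fun e => e.2 = v), (6 - (F.degree e.1 : ℤ)) =
        ((D.filter fun e => e.2 = v ∧ F.degree e.1 ≤ 3).card : ℤ) +
        (D.filter fun e => e.2 = v ∧ F.degree e.1 ≤ 4).card +
        (D.filter fun e => e.2 = v ∧ F.degree e.1 ≤ 5).card := by
      simp only [← Finset.filter_filter, Finset.card_filter _ (D.filter fun e => e.2 = v)]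
      push_cast
      rw [← Finset.sum_add_distrib, ← Finset.sum_add_distrib]
      refine Finset.sum_congr rfl fun e he => ?_
      obtain ⟨-, h5, h3, -⟩ := hB e (hDB (Finset.mem_filter.1 he).1)
      split_ifs <;> omega
    have h3 := hD v 3
    have h4 := hD v 4
    have h5 := hD v 5
    have := hΔ v
    rw [h1]
    omega
  have hfst : ∑ e ∈ D, (6 - (F.degree e.1 : ℤ)) =
      ∑ u ∈ W.filter (fun u => F.degree u ≤ 5), ∑ e ∈ D.filter (fun e => e.1 = u),
        (6 - (F.degree e.1 : ℤ)) := by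
    refine (Finset.sum_fiberwise_of_maps_to (fun e he => ?_) _).symm
    obtain ⟨-, h5, h3, -⟩ := hB e (hDB he)
    simp only [hW, Finset.mem_filter, Finset.mem_univ, true_and]
    omega
  have hsnd : ∑ e ∈ D, (6 - (F.degree e.1 : ℤ)) =
      ∑ v ∈ W.filter (fun v => ¬ F.degree v ≤ 5), ∑ e ∈ D.filter (fun e => e.2 = v),
        (6 - (F.degree e.1 : ℤ)) := by
    refine (Finset.sum_fiberwise_of_maps_to (fun e he => ?_) _).symm
    obtain ⟨-, -, -, h6⟩ := hB e (hDB he)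
    simp only [hW, Finset.mem_filter, Finset.mem_univ, true_and]
    omega
  have hle1 : ∑ u ∈ W.filter (fun u => F.degree u ≤ 5), 2 * (6 - (F.degree u : ℤ)) ≤
      ∑ e ∈ D, (6 - (F.degree e.1 : ℤ)) := by
    rw [hfst]
    refine Finset.sum_le_sum fun u hu => ?_
    obtain ⟨huW, hu5⟩ := Finset.mem_filter.1 hu
    have h2 := hsmall u huW hu5
    rw [Finset.sum_congr rfl (g := fun _ => 6 - (F.degree u : ℤ))
      (fun e he => by rw [(Finset.mem_filter.1 he).2]), Finset.sum_const, nsmul_eq_mul]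
    exact mul_le_mul_of_nonneg_right (by exact_mod_cast h2) (by omega)
  have hle2 : ∑ e ∈ D, (6 - (F.degree e.1 : ℤ)) ≤
      ∑ v ∈ W.filter (fun v => ¬ F.degree v ≤ 5), 2 * ((F.degree v : ℤ) - 6) := by
    rw [hsnd]
    refine Finset.sum_le_sum fun v hv => hbig v ?_
    have := (Finset.mem_filter.1 hv).2
    omega
  rw [← Finset.sum_filter_add_sum_filter_not W (fun v => F.degree v ≤ 5)] at hsum
  rw [← Finset.mul_sum] at hle1 hle2
  have hneg : ∑ u ∈ W.filter (fun u => F.degree u ≤ 5), (6 - (F.degree u : ℤ)) =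
      - ∑ u ∈ W.filter (fun u => F.degree u ≤ 5), ((F.degree u : ℤ) - 6) := by
    rw [← Finset.sum_neg_distrib]
    exact Finset.sum_congr rfl fun u _ => by ring
  linarith

end Discharging

section Extension

variable {V : Type*} [Fintype V]

/-- A list edge-coloring of `F` minus a bipartite edge set `H` extends to `F` when both ends of
every edge `uv` of `H` have degree at least `d(u) + d(v) - k` in `H`, `k` being the list size. -/
theorem exists_coloring_extension (F : SimpleGraph V) (k : ℕ) (L : Sym2 V → Finset ℕ)
    (hL : ∀ e ∈ F.edgeSet, k ≤ (L e).card) (H : Finset (V × V))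
    (hadj : ∀ e ∈ H, F.Adj e.1 e.2) (hbip : ∀ e ∈ H, ∀ f ∈ H, e.1 ≠ f.2)
    (hdeg : ∀ e ∈ H, F.degree e.1 + F.degree e.2 ≤ (H.filter fun f => f.1 = e.1).card + k ∧
        F.degree e.1 + F.degree e.2 ≤ (H.filter fun f => f.2 = e.2).card + k)
    (f : Sym2 V → ℕ)
    (hf : IsProperListEdgeColoring (F.deleteEdges ((fun e : V × V => s(e.1, e.2)) '' H)) L f) :
    ∃ g, IsProperListEdgeColoring F L g := by
  set F' := F.deleteEdges ((fun e : V × V => s(e.1, e.2)) '' (H : Set (V × V))) with hF'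
  have hF'adj : ∀ u v, F'.Adj u v ↔ F.Adj u v ∧ (u, v) ∉ H ∧ (v, u) ∉ H := by
    intro u v
    rw [hF', SimpleGraph.deleteEdges_adj]
    refine and_congr_right fun _ => ?_
    simp only [Set.mem_image, Finset.mem_coe, Prod.exists, Sym2.eq_iff, not_exists, not_and]
    constructor
    · intro h
      exact ⟨fun h' => h u v h' (Or.inl ⟨rfl, rfl⟩), fun h' => h v u h' (Or.inr ⟨rfl, rfl⟩)⟩
    · rintro ⟨h1, h2⟩ x y hxy (⟨rfl, rfl⟩ | ⟨rfl, rfl⟩)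
      · exact h1 hxy
      · exact h2 hxy
  have hfst : ∀ e ∈ H, (F'.neighborFinset e.1).card + (H.filter fun x => x.1 = e.1).card ≤
      F.degree e.1 := by
    intro e he
    have hinj : ((H.filter fun x => x.1 = e.1).image Prod.snd).card =
        (H.filter fun x => x.1 = e.1).card :=
      Finset.card_image_of_injOn fun x hx y hy hxy => by
        rw [Finset.mem_coe, Finset.mem_filter] at hx hy
        exact Prod.ext (hx.2.trans hy.2.symm) hxy
    rw [← hinj, ← Finset.card_union_of_disjoint, ← F.card_neighborFinset_eq_degree]
    · refine Finset.card_le_card (Finset.union_subset (fun w hw => ?_) fun w hw => ?_)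
      · rw [SimpleGraph.mem_neighborFinset] at hw ⊢
        exact ((hF'adj _ _).1 hw).1
      · obtain ⟨x, hx, rfl⟩ := Finset.mem_image.1 hw
        obtain ⟨hx, hxe⟩ := Finset.mem_filter.1 hx
        rw [SimpleGraph.mem_neighborFinset, ← hxe]
        exact hadj x hx
    · refine Finset.disjoint_left.2 fun w hw hw' => ?_
      obtain ⟨x, hx, rfl⟩ := Finset.mem_image.1 hw'
      obtain ⟨hx, hxe⟩ := Finset.mem_filter.1 hx
      rw [SimpleGraph.mem_neighborFinset, ← hxe] at hw
      exact ((hF'adj _ _).1 hw).2.1 hx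
  have hsnd : ∀ e ∈ H, (F'.neighborFinset e.2).card + (H.filter fun x => x.2 = e.2).card ≤
      F.degree e.2 := by
    intro e he
    have hinj : ((H.filter fun x => x.2 = e.2).image Prod.fst).card =
        (H.filter fun x => x.2 = e.2).card :=
      Finset.card_image_of_injOn fun x hx y hy hxy => by
        rw [Finset.mem_coe, Finset.mem_filter] at hx hy
        exact Prod.ext hxy (hx.2.trans hy.2.symm)
    rw [← hinj, ← Finset.card_union_of_disjoint, ← F.card_neighborFinset_eq_degree]
    · refine Finset.card_le_card (Finset.union_subset (fun w hw => ?_) fun w hw => ?_)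
      · rw [SimpleGraph.mem_neighborFinset] at hw ⊢
        exact ((hF'adj _ _).1 hw).1
      · obtain ⟨x, hx, rfl⟩ := Finset.mem_image.1 hw
        obtain ⟨hx, hxe⟩ := Finset.mem_filter.1 hx
        rw [SimpleGraph.mem_neighborFinset, ← hxe]
        exact (hadj x hx).symm
    · refine Finset.disjoint_left.2 fun w hw hw' => ?_
      obtain ⟨x, hx, rfl⟩ := Finset.mem_image.1 hw'
      obtain ⟨hx, hxe⟩ := Finset.mem_filter.1 hx
      rw [SimpleGraph.mem_neighborFinset, ← hxe] at hw
      exact ((hF'adj _ _).1 hw).2.2 hx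
  let used : V → Finset ℕ := fun v => (F'.neighborFinset v).image fun w => f s(v, w)
  have hlist : ∀ e ∈ H, k ≤ (L s(e.1, e.2) \ (used e.1 ∪ used e.2)).card +
      ((F'.neighborFinset e.1).card + (F'.neighborFinset e.2).card) := by
    intro e he
    have h1 := hL s(e.1, e.2) (hadj e he)
    have h2 := Finset.le_card_sdiff (used e.1 ∪ used e.2) (L s(e.1, e.2))
    have h3 : (used e.1 ∪ used e.2).card ≤
        (F'.neighborFinset e.1).card + (F'.neighborFinset e.2).card :=
      (Finset.card_union_le _ _).trans (add_le_add Finset.card_image_le Finset.card_image_le)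
    omega
  obtain ⟨c, hcL, hc⟩ := exists_list_coloring_of_degree_le Prod.fst Prod.snd H
    (fun e => L s(e.1, e.2) \ (used e.1 ∪ used e.2))
    (fun e he => by
      have h1 := hlist e he
      have h2 := hfst e he
      have h3 := hsnd e he
      have h4 := hdeg e he
      omega)
    (fun e he => by
      have h1 := hlist e he
      have h2 := hfst e he
      have h3 := hsnd e he
      have h4 := hdeg e he
      omega)
  have hinj : ∀ e ∈ H, ∀ e' ∈ H, s(e.1, e.2) = s(e'.1, e'.2) → e = e' := by
    intro e he e' he' h
    rcases Sym2.eq_iff.1 h with h | h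
    · exact Prod.ext h.1 h.2
    · exact absurd h.1 (hbip e he e' he')
  let g : Sym2 V → ℕ := fun x => if h : ∃ e ∈ H, s(e.1, e.2) = x then c h.choose else f x
  have hgH : ∀ e ∈ H, g s(e.1, e.2) = c e := by
    intro e he
    have h : ∃ e' ∈ H, s(e'.1, e'.2) = s(e.1, e.2) := ⟨e, he, rfl⟩
    simp only [g, dif_pos h]
    rw [hinj _ h.choose_spec.1 e he h.choose_spec.2]
  have hcases : ∀ x ∈ F.edgeSet, (∃ e ∈ H, s(e.1, e.2) = x) ∨ (x ∈ F'.edgeSet ∧ g x = f x) := by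
    intro x hx
    by_cases h : ∃ e ∈ H, s(e.1, e.2) = x
    · exact Or.inl h
    · refine Or.inr ⟨?_, by simp only [g, dif_neg h]⟩
      rw [hF', SimpleGraph.edgeSet_deleteEdges]
      exact ⟨hx, fun h' => h (by simpa using h')⟩
  have havoid : ∀ e ∈ H, ∀ x ∈ F'.edgeSet, (∃ v, v ∈ s(e.1, e.2) ∧ v ∈ x) → c e ≠ f x := by
    rintro e he x hx ⟨v, hve, hvx⟩ heq
    obtain ⟨w, rfl⟩ := Sym2.mem_iff_exists.1 hvx
    have hmem : f s(v, w) ∈ used v := Finset.mem_image.2 ⟨w, by simpa using hx, rfl⟩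
    have hnot := (Finset.mem_sdiff.1 (hcL e he)).2
    rw [heq, Finset.mem_union, not_or] at hnot
    rcases Sym2.mem_iff.1 hve with rfl | rfl
    · exact hnot.1 hmem
    · exact hnot.2 hmem
  refine ⟨g, fun x hx => ?_, fun x hx y hy hxy hv => ?_⟩
  · rcases hcases x hx with ⟨e, he, rfl⟩ | ⟨hx', hgx⟩
    · rw [hgH e he]
      exact (Finset.mem_sdiff.1 (hcL e he)).1
    · rw [hgx]
      exact hf.1 x hx'
  · rcases hcases x hx with ⟨e, he, rfl⟩ | ⟨hx', hgx⟩ <;>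
      rcases hcases y hy with ⟨e', he', rfl⟩ | ⟨hy', hgy⟩
    · rw [hgH e he, hgH e' he']
      refine hc e he e' he' (fun h => hxy (by rw [h])) ?_
      obtain ⟨v, hv1, hv2⟩ := hv
      rcases Sym2.mem_iff.1 hv1 with h1 | h1 <;> rcases Sym2.mem_iff.1 hv2 with h2 | h2
      · exact Or.inl (h1.symm.trans h2)
      · exact absurd (h1.symm.trans h2) (hbip e he e' he')
      · exact absurd (h2.symm.trans h1) (hbip e' he' e he)
      · exact Or.inr (h1.symm.trans h2)
    · rw [hgH e he, hgy]
      exact havoid e he y hy' hv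
    · rw [hgH e' he', hgx]
      obtain ⟨v, hv1, hv2⟩ := hv
      exact (havoid e' he' x hx' ⟨v, hv2, hv1⟩).symm
    · rw [hgx, hgy]
      exact hf.2 x hx' y hy' hxy hv

/-- Every nonempty spanning subgraph of a graph of maximum average degree below `6` has average
degree below `6` over its non-isolated vertices. -/
theorem MadLT.sum_degree_sub_six_neg {G : SimpleGraph V} (hmad : MadLT G 6) {F : SimpleGraph V}
    (hFG : F ≤ G) (hF : F ≠ ⊥) :
    ∑ v ∈ Finset.univ.filter (fun v => 0 < F.degree v), ((F.degree v : ℤ) - 6) < 0 := by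
  let S : G.Subgraph :=
    { verts := F.support
      Adj := F.Adj
      adj_sub := fun h => hFG h
      edge_vert := fun h => ⟨_, h⟩
      symm := F.symm }
  obtain ⟨u, v, huv⟩ := SimpleGraph.ne_bot_iff_exists_adj.1 hF
  have hW : ∀ _ : Fintype S.verts,
      S.verts.toFinset = Finset.univ.filter fun v => 0 < F.degree v := by
    intro _
    ext w
    simp [S, SimpleGraph.mem_support, SimpleGraph.degree_pos_iff_exists_adj]
  have hdeg : ∀ w, (S.neighborSet w).ncard = F.degree w := fun w => by
    rw [← F.card_neighborFinset_eq_degree, ← Set.ncard_coe_finset, SimpleGraph.coe_neighborFinset]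
    rfl
  have h := hmad S ⟨u, v, huv⟩
  simp only [hdeg, hW] at h
  set W := Finset.univ.filter fun v => 0 < F.degree v
  have hpos : (0 : ℝ) < W.card := by
    exact_mod_cast Finset.card_pos.2
      ⟨u, by simpa [W] using (F.degree_pos_iff_exists_adj u).2 ⟨v, huv⟩⟩
  rw [div_lt_iff₀ hpos] at h
  rw [Finset.sum_sub_distrib, Finset.sum_const, nsmul_eq_mul, sub_neg]
  have h' : ∑ v ∈ W, F.degree v < 6 * W.card := by exact_mod_cast h
  rw [mul_comm]
  exact_mod_cast h'

end Extension

theorem stmt_11 {V : Type*} [Fintype V] (G : SimpleGraph V) [DecidableRel G.Adj]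
    (Δ : ℕ) (hΔ : G.maxDegree = Δ) (hΔ9 : 9 ≤ Δ) (hmad : MadLT G 6) :
    listChromaticIndex G ≤ Δ + 1 := by
  refine Nat.sInf_le ?_
  intro L hL
  suffices h : ∀ F : SimpleGraph V, F ≤ G → ∃ f, IsProperListEdgeColoring F L f from h G le_rfl
  intro F
  induction F using WellFoundedLT.induction with
  | ind F ih =>
  intro hFG
  by_cases hF : F = ⊥
  · subst hF
    exact ⟨fun _ => 0, by simp [IsProperListEdgeColoring]⟩
  have hdeg : ∀ v, F.degree v ≤ Δ := fun v => by
    rw [← hΔ]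
    refine le_trans ?_ (G.degree_le_maxDegree v)
    rw [← F.card_neighborFinset_eq_degree, ← G.card_neighborFinset_eq_degree]
    refine Finset.card_le_card fun w hw => ?_
    rw [SimpleGraph.mem_neighborFinset] at hw ⊢
    exact hFG hw
  obtain ⟨H, ⟨e, he⟩, hadj, hbip, hH⟩ :=
    exists_reducible_bipartite F Δ hdeg hΔ9 (hmad.sum_degree_sub_six_neg hFG hF)
  have hle : F.deleteEdges ((fun e : V × V => s(e.1, e.2)) '' (H : Set (V × V))) ≤ F :=
    SimpleGraph.deleteEdges_le _
  obtain ⟨f, hf⟩ := ih _ (lt_of_le_of_ne hle fun heq => by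
    have h := hadj e he
    rw [← heq, SimpleGraph.deleteEdges_adj] at h
    exact h.2 ⟨e, he, rfl⟩) (hle.trans hFG)
  exact exists_coloring_extension F (Δ + 1) L
    (fun x hx => hL x (SimpleGraph.edgeSet_mono hFG hx)) H hadj hbip hH f hf
end

section
/- If G is a finite simple graph with maximum degree Δ ≥ 5 and mad(G) < 4, then χ'_ℓ(G) ≤ Δ + 1. -/
open scoped Classical

open SimpleGraph

section CyclicColoring

/-- A greedy choice from lists of size at least two along a ray, with prescribed first value. -/
lemma exists_greedy_choice (L : ℕ → Finset ℕ) (hL : ∀ i, 2 ≤ (L i).card) (a : ℕ) :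
    ∃ c : ℕ → ℕ, c 0 = a ∧ ∀ i, c (i + 1) ∈ L (i + 1) ∧ c (i + 1) ≠ c i := by
  have h (i b : ℕ) : ∃ x ∈ L i, x ≠ b := Finset.exists_mem_ne (hL i) b
  choose next hmem hne using h
  exact ⟨fun n ↦ Nat.rec a (fun i b ↦ next (i + 1) b) n, rfl,
    fun i ↦ ⟨hmem _ _, hne _ _⟩⟩

/-- Even cycles are 2-choosable, stated for periodic sequences of lists. -/
lemma exists_periodic_choice {n : ℕ} (hn : Even n) (hn0 : 0 < n) (L : ℕ → Finset ℕ)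
    (hL : ∀ i, 2 ≤ (L i).card) (hper : Function.Periodic L n) :
    ∃ c : ℕ → ℕ, Function.Periodic c n ∧ (∀ i, c i ∈ L i) ∧ ∀ i, c (i + 1) ≠ c i := by
  by_cases hsub : ∀ i, L (i + 1) ⊆ L i
  · have hanti : Antitone L := antitone_nat_of_succ_le hsub
    have hconst (i : ℕ) : L i = L 0 := by
      refine le_antisymm (hanti (Nat.zero_le i)) ?_
      have h := hper.nat_mul i 0
      rw [Nat.cast_id, zero_add] at h
      rw [← h]
      exact hanti (Nat.le_mul_of_pos_right i hn0)
    obtain ⟨a, ha, b, hb, hab⟩ := Finset.one_lt_card.1 (hL 0)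
    refine ⟨fun i ↦ if i % 2 = 0 then a else b, fun i ↦ ?_, fun i ↦ ?_, fun i ↦ ?_⟩
    · obtain ⟨m, rfl⟩ := hn
      have : (i + (m + m)) % 2 = i % 2 := by lia
      simp only [this]
    · rw [hconst]
      dsimp only
      split_ifs <;> assumption
    · rcases Nat.mod_two_eq_zero_or_one i with h | h
      · have : (i + 1) % 2 = 1 := by lia
        simp [h, this, hab.symm]
      · have : (i + 1) % 2 = 0 := by lia
        simp [h, this, hab]
  · push Not at hsub
    obtain ⟨i, hi⟩ := hsub
    obtain ⟨a, ha, ha'⟩ := Finset.not_subset.1 hi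
    obtain ⟨c, hc0, hc⟩ := exists_greedy_choice (fun j ↦ L (i + 1 + j)) (fun _ ↦ hL _) a
    have hcmem (j : ℕ) : c j ∈ L (i + 1 + j) := by
      cases j with
      | zero => rw [hc0]; exact ha
      | succ j => exact (hc j).1
    obtain ⟨m, hm⟩ : ∃ m, i + 1 + m = n * (i + 1) :=
      ⟨n * (i + 1) - (i + 1), Nat.add_sub_cancel' (Nat.le_mul_of_pos_left _ hn0)⟩
    have hmod (j : ℕ) : L (j % n) = L j := hper.map_mod_nat j
    refine ⟨fun j ↦ c ((j + m) % n), fun j ↦ ?_, fun j ↦ ?_, fun j ↦ ?_⟩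
    · have : (j + n + m) % n = (j + m) % n := by
        rw [show j + n + m = j + m + n by ring, Nat.add_mod_right]
      simp only [this]
    · have h := hcmem ((j + m) % n)
      have e : L (i + 1 + (j + m) % n) = L j := by
        rw [← hmod, Nat.add_mod_mod, show i + 1 + (j + m) = j + n * (i + 1) by lia,
          Nat.add_mul_mod_self_left, hmod]
      rwa [e] at h
    · have hr : (j + m) % n < n := Nat.mod_lt _ hn0
      have hs : (j + 1 + m) % n = ((j + m) % n + 1) % n := by
        rw [Nat.mod_add_mod]; congr 1; ring
      dsimp only
      rw [hs]
      rcases Nat.lt_or_ge ((j + m) % n + 1) n with hlt | hge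
      · rw [Nat.mod_eq_of_lt hlt]
        exact (hc _).2
      · have hrn : (j + m) % n + 1 = n := by lia
        rw [hrn, Nat.mod_self, hc0]
        have h := hcmem ((j + m) % n)
        rw [show i + 1 + (j + m) % n = i + n by lia, hper i] at h
        rintro rfl
        exact ha' h

/-- The edges of an even cycle, given by a periodic sequence of vertices, can be properly colored
from lists of size at least two. -/
lemma exists_cycle_edge_choice {V : Type*} {n : ℕ} (hn : Even n) (hn3 : 3 ≤ n) (v : ℕ → V)
    (hper : Function.Periodic v n) (hinj : ∀ i j, v i = v j → i ≡ j [MOD n])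
    (L : Sym2 V → Finset ℕ) (hL : ∀ i, 2 ≤ (L s(v i, v (i + 1))).card) :
    ∃ g : Sym2 V → ℕ, (∀ i, g s(v i, v (i + 1)) ∈ L s(v i, v (i + 1))) ∧
      ∀ i j, s(v i, v (i + 1)) ≠ s(v j, v (j + 1)) →
        (∃ x, x ∈ s(v i, v (i + 1)) ∧ x ∈ s(v j, v (j + 1))) →
        g s(v i, v (i + 1)) ≠ g s(v j, v (j + 1)) := by
  have hvmod {i j : ℕ} (h : i ≡ j [MOD n]) : v i = v j := by
    rw [← hper.map_mod_nat i, ← hper.map_mod_nat j, h]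
  obtain ⟨c, hcper, hcmem, hcne⟩ := exists_periodic_choice hn (by lia)
    (fun i ↦ L s(v i, v (i + 1))) hL (fun i ↦ by
      dsimp only
      rw [hper i, show i + n + 1 = i + 1 + n by ring, hper (i + 1)])
  have hcmod {i j : ℕ} (h : i ≡ j [MOD n]) : c i = c j := by
    rw [← hcper.map_mod_nat i, ← hcper.map_mod_nat j, h]
  have hE (i j : ℕ) (h : s(v i, v (i + 1)) = s(v j, v (j + 1))) : c i = c j := by
    rcases Sym2.eq_iff.1 h with ⟨h1, -⟩ | ⟨h1, h2⟩
    · exact hcmod (hinj _ _ h1)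
    · exfalso
      have h3 : j + 2 ≡ j + 0 [MOD n] := ((hinj _ _ h1).add_right 1).symm.trans (hinj _ _ h2)
      have h4 := Nat.ModEq.add_left_cancel' j h3
      have := Nat.le_of_dvd (by lia) ((Nat.modEq_zero_iff_dvd).1 h4)
      lia
  let g : Sym2 V → ℕ := fun e ↦ if h : ∃ i, s(v i, v (i + 1)) = e then c h.choose else 0
  have hg (i : ℕ) : g s(v i, v (i + 1)) = c i := by
    have h : ∃ k, s(v k, v (k + 1)) = s(v i, v (i + 1)) := ⟨i, rfl⟩
    simp only [g, dif_pos h]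
    exact hE _ _ h.choose_spec
  refine ⟨g, fun i ↦ by rw [hg]; exact hcmem i, fun i j hne ⟨x, hxi, hxj⟩ ↦ ?_⟩
  rw [hg, hg]
  rw [Sym2.mem_iff] at hxi hxj
  rcases hxi with rfl | rfl <;> rcases hxj with h | h
  · have := hinj _ _ h
    rw [hvmod this, hvmod (this.add_right 1)] at hne
    exact absurd rfl hne
  · rw [hcmod (hinj _ _ h)]
    exact hcne j
  · rw [← hcmod (hinj _ _ h)]
    exact (hcne i).symm
  · have := (hinj _ _ h).add_right_cancel' 1
    rw [hvmod this, hvmod (this.add_right 1)] at hne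
    exact absurd rfl hne

end CyclicColoring

section Extension

variable {V : Type*} [Fintype V]

/-- The colors used by `f` on the edges of `G` that meet `e`. -/
noncomputable def usedColors (G : SimpleGraph V) (f : Sym2 V → ℕ) (e : Sym2 V) : Finset ℕ :=
  (G.edgeFinset.filter fun e' ↦ ∃ x, x ∈ e ∧ x ∈ e').image f

lemma card_usedColors_le (G : SimpleGraph V) (f : Sym2 V → ℕ) (u w : V) :
    (usedColors G f s(u, w)).card ≤ G.degree u + G.degree w := by
  rw [← card_incidenceFinset_eq_degree, ← card_incidenceFinset_eq_degree]
  refine Finset.card_image_le.trans ((Finset.card_le_card ?_).trans (Finset.card_union_le _ _))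
  intro e he
  simp only [Finset.mem_filter, mem_edgeFinset, Sym2.mem_iff] at he
  obtain ⟨he, x, rfl | rfl, hx⟩ := he
  · exact Finset.mem_union_left _ ((mem_incidenceFinset ..).2 ⟨he, hx⟩)
  · exact Finset.mem_union_right _ ((mem_incidenceFinset ..).2 ⟨he, hx⟩)

/-- A coloring of `G` minus a set of edges extends to `G` by a proper coloring of that set of
edges from the remaining colors. -/
lemma IsProperListEdgeColoring.extend {G G' : SimpleGraph V} {L : Sym2 V → Finset ℕ}
    {C : Set (Sym2 V)} (hG' : G' = G.deleteEdges C) {f g : Sym2 V → ℕ}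
    (hf : IsProperListEdgeColoring G' L f)
    (hg : ∀ e ∈ C, g e ∈ L e \ usedColors G' f e)
    (hgne : ∀ e₁ ∈ C, ∀ e₂ ∈ C, e₁ ≠ e₂ → (∃ x, x ∈ e₁ ∧ x ∈ e₂) → g e₁ ≠ g e₂) :
    ∃ h, IsProperListEdgeColoring G L h := by
  have hmem {e : Sym2 V} (he : e ∈ G.edgeSet) (heC : e ∉ C) : e ∈ G'.edgeSet := by
    rw [hG', edgeSet_deleteEdges]
    exact ⟨he, heC⟩
  have hcross {e₁ e₂ : Sym2 V} (h₁ : e₁ ∈ C) (h₂ : e₂ ∈ G'.edgeSet)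
      (hx : ∃ x, x ∈ e₁ ∧ x ∈ e₂) : g e₁ ≠ f e₂ := by
    intro h
    refine (Finset.mem_sdiff.1 (hg e₁ h₁)).2 ?_
    rw [h]
    exact Finset.mem_image_of_mem _ (Finset.mem_filter.2 ⟨mem_edgeFinset.2 h₂, hx⟩)
  refine ⟨fun e ↦ if e ∈ C then g e else f e, fun e he ↦ ?_, fun e₁ h₁ e₂ h₂ hne hx ↦ ?_⟩
  · dsimp only
    split_ifs with hC
    · exact (Finset.mem_sdiff.1 (hg e hC)).1
    · exact hf.1 e (hmem he hC)
  · dsimp only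
    split_ifs with hC₁ hC₂ hC₂
    · exact hgne _ hC₁ _ hC₂ hne hx
    · exact hcross hC₁ (hmem h₂ hC₂) hx
    · exact (hcross hC₂ (hmem h₁ hC₁) (hx.imp fun _ h ↦ h.symm)).symm
    · exact hf.2 _ (hmem h₁ hC₁) _ (hmem h₂ hC₂) hne hx

/-- A coloring of `G - uw` extends to `G` if the lists are longer than the number of edges
adjacent to `uw`. -/
lemma IsProperListEdgeColoring.extend_edge {G G' : SimpleGraph V} {L : Sym2 V → Finset ℕ}
    {u w : V} (huw : G.Adj u w) (hG' : G' = G.deleteEdges {s(u, w)}) {f : Sym2 V → ℕ}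
    (hf : IsProperListEdgeColoring G' L f)
    (hL : G.degree u + G.degree w < (L s(u, w)).card + 2) :
    ∃ h, IsProperListEdgeColoring G L h := by
  have hdeg {x y : V} (hxy : G.Adj x y) (hs : s(x, y) = s(u, w)) :
      G'.degree x + 1 ≤ G.degree x := by
    rw [← card_neighborFinset_eq_degree, ← card_neighborFinset_eq_degree]
    refine Finset.card_lt_card (Finset.ssubset_iff.2 ⟨y, ?_, ?_⟩)
    · simp [hG', hs]
    · intro z hz
      rcases Finset.mem_insert.1 hz with rfl | hz
      · simpa using hxy
      · rw [mem_neighborFinset, hG', deleteEdges_adj] at hz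
        simpa using hz.1
  have hu := hdeg huw rfl
  have hw := hdeg huw.symm Sym2.eq_swap
  have hused := card_usedColors_le G' f u w
  have hcard := Finset.le_card_sdiff (usedColors G' f s(u, w)) (L s(u, w))
  obtain ⟨a, ha⟩ : (L s(u, w) \ usedColors G' f s(u, w)).Nonempty :=
    Finset.card_pos.1 (by lia)
  refine hf.extend hG' (g := fun _ ↦ a) ?_ ?_
  · rintro e rfl
    exact ha
  · rintro e₁ rfl e₂ rfl h
    exact absurd rfl h

/-- A coloring of `G` minus the edges of an even cycle extends to `G` if the list of each edge of
the cycle has two more colors than the number of its adjacent edges off the cycle. -/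
lemma IsProperListEdgeColoring.extend_cycle {G G' : SimpleGraph V} {L : Sym2 V → Finset ℕ}
    {n : ℕ} (hn : Even n) (hn3 : 3 ≤ n) {v : ℕ → V} (hper : Function.Periodic v n)
    (hinj : ∀ i j, v i = v j → i ≡ j [MOD n]) (hadj : ∀ i, G.Adj (v i) (v (i + 1)))
    (hG' : G' = G.deleteEdges (Set.range fun i ↦ s(v i, v (i + 1)))) {f : Sym2 V → ℕ}
    (hf : IsProperListEdgeColoring G' L f)
    (hL : ∀ i, G.degree (v i) + G.degree (v (i + 1)) ≤ (L s(v i, v (i + 1))).card + 2) :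
    ∃ h, IsProperListEdgeColoring G L h := by
  have hdeg (i : ℕ) : G'.degree (v i) + 2 ≤ G.degree (v i) := by
    have hprev : v (i + (n - 1) + 1) = v i := by
      rw [show i + (n - 1) + 1 = i + n by lia, hper]
    have hne : v (i + 1) ≠ v (i + (n - 1)) := by
      intro h
      have h1 := Nat.ModEq.add_left_cancel' i (hinj _ _ h)
      rw [Nat.ModEq, Nat.mod_eq_of_lt (by lia), Nat.mod_eq_of_lt (by lia)] at h1
      lia
    have hsub : G'.neighborFinset (v i) ⊆
        G.neighborFinset (v i) \ {v (i + 1), v (i + (n - 1))} := by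
      intro z hz
      rw [mem_neighborFinset, hG', deleteEdges_adj] at hz
      rw [Finset.mem_sdiff, mem_neighborFinset]
      refine ⟨hz.1, fun h ↦ hz.2 ?_⟩
      rcases Finset.mem_insert.1 h with rfl | h
      · exact ⟨i, rfl⟩
      · rw [Finset.mem_singleton.1 h]
        exact ⟨i + (n - 1), by dsimp only; rw [hprev, Sym2.eq_swap]⟩
    have hpair : {v (i + 1), v (i + (n - 1))} ⊆ G.neighborFinset (v i) := by
      intro z hz
      rw [mem_neighborFinset]
      rcases Finset.mem_insert.1 hz with rfl | h
      · exact hadj i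
      · rw [Finset.mem_singleton.1 h]
        have := hadj (i + (n - 1))
        rw [hprev] at this
        exact this.symm
    have h1 := Finset.card_le_card hsub
    have h2 := Finset.card_le_card hpair
    rw [Finset.card_sdiff_of_subset hpair] at h1
    rw [Finset.card_pair hne] at h1 h2
    rw [card_neighborFinset_eq_degree] at h1 h2
    rw [card_neighborFinset_eq_degree] at h1
    lia
  obtain ⟨g, hg, hgne⟩ := exists_cycle_edge_choice hn hn3 v hper hinj
    (fun e ↦ L e \ usedColors G' f e) (fun i ↦ by
      have hused := card_usedColors_le G' f (v i) (v (i + 1))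
      have hcard := Finset.le_card_sdiff (usedColors G' f s(v i, v (i + 1)))
        (L s(v i, v (i + 1)))
      have := hdeg i
      have := hdeg (i + 1)
      have := hL i
      lia)
  refine hf.extend hG' (g := g) ?_ ?_
  · rintro _ ⟨i, rfl⟩
    exact hg i
  · rintro _ ⟨i, rfl⟩ _ ⟨j, rfl⟩
    exact hgne i j

end Extension

/-- A cycle gives a periodic sequence of vertices. -/
lemma SimpleGraph.Walk.IsCycle.exists_periodic {V : Type*} {H : SimpleGraph V} {u : V} {p : H.Walk u u}
    (hp : p.IsCycle) : ∃ v : ℕ → V, Function.Periodic v p.length ∧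
      (∀ i j, v i = v j → i ≡ j [MOD p.length]) ∧ ∀ i, H.Adj (v i) (v (i + 1)) := by
  have h3 := hp.three_le_length
  have hlt (i : ℕ) : i % p.length < p.length := Nat.mod_lt _ (by lia)
  refine ⟨fun i ↦ p.getVert (i % p.length), fun i ↦ by simp, fun i j h ↦ ?_, fun i ↦ ?_⟩
  · exact hp.getVert_injOn' (Nat.le_sub_one_of_lt (hlt i)) (Nat.le_sub_one_of_lt (hlt j)) h
  · have h := p.adj_getVert_succ (hlt i)
    convert h using 1
    dsimp only
    rw [← Nat.mod_add_mod]
    rcases Nat.lt_or_ge (i % p.length + 1) p.length with h1 | h1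
    · rw [Nat.mod_eq_of_lt h1]
    · rw [show i % p.length + 1 = p.length by have := hlt i; lia, Nat.mod_self]
      simp

section Counting

variable {V : Type*} [Fintype V]

lemma SimpleGraph.IsAcyclic.card_edgeFinset_lt [Nonempty V] {H : SimpleGraph V}
    (hH : H.IsAcyclic) : H.edgeFinset.card < Fintype.card V := by
  obtain ⟨F, hHF, -, hF⟩ := connected_top.exists_isTree_le_of_le_of_isAcyclic le_top hH
  have := Finset.card_le_card (edgeFinset_mono hHF)
  have := hF.card_edgeFinset
  lia

lemma SimpleGraph.IsAcyclic.card_edgeFinset_le_of_support_subset {H : SimpleGraph V}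
    (hH : H.IsAcyclic) {s : Finset V} (hs : H.support ⊆ s) : H.edgeFinset.card ≤ s.card := by
  rcases s.eq_empty_or_nonempty with rfl | hne
  · have : H = ⊥ := by
      rw [← support_eq_bot_iff]
      simpa using hs
    subst this
    simp
  · have : Nonempty (s : Set V) := hne.to_subtype
    have h : H.edgeFinset.card < Fintype.card (s : Set V) := by
      rw [← card_edgeFinset_induce_of_support_subset hs]
      convert (hH.induce (s : Set V)).card_edgeFinset_lt
    simpa using h.le

lemma MadLT.sum_degree_lt_s12 {G G' : SimpleGraph V} {m : ℕ} (h : MadLT G m) (hle : G' ≤ G)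
    (hne : G'.support.Nonempty) :
    ∑ v ∈ G'.support.toFinset, G'.degree v < m * G'.support.toFinset.card := by
  let H : G.Subgraph :=
    { verts := G'.support
      Adj := G'.Adj
      adj_sub := fun h ↦ hle h
      edge_vert := fun h ↦ ⟨_, h⟩
      symm := G'.symm }
  have hH := h H hne
  have hpos : (0 : ℝ) < G'.support.toFinset.card := by
    exact_mod_cast Finset.card_pos.2 (by simpa using hne)
  have hdeg (v : V) : (H.neighborSet v).ncard = G'.degree v := by
    rw [← card_neighborSet_eq_degree, ← Nat.card_eq_fintype_card]
    rfl
  generalize hS : G'.support.toFinset = S at hpos ⊢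
  have hverts (_ : Fintype H.verts) : H.verts.toFinset = S := by
    rw [← hS]
    ext
    simp [H]
  simp only [hdeg, hverts] at hH
  rw [div_lt_iff₀ hpos] at hH
  exact_mod_cast hH

/-- The edges of `G` joining a vertex of degree `a` to a vertex of degree `b`. -/
def degreePairGraph (G : SimpleGraph V) (a b : ℕ) : SimpleGraph V where
  Adj u w := G.Adj u w ∧ (G.degree u = a ∧ G.degree w = b ∨ G.degree u = b ∧ G.degree w = a)
  symm := ⟨fun _ _ h ↦ ⟨h.1.symm, by tauto⟩⟩
  loopless := ⟨fun _ h ↦ h.1.ne rfl⟩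

/-- If every neighbor of a vertex of degree `a` has degree `b`, and the edges between these two
degree classes form a forest, then there are at least `a - 1` times as many vertices of degree `b`
as vertices of degree `a`. -/
lemma mul_card_degree_le {G : SimpleGraph V} {a b : ℕ} (hab : a ≠ b)
    (hnbr : ∀ u w, G.Adj u w → G.degree u = a → G.degree w = b)
    (hacyc : (degreePairGraph G a b).IsAcyclic) :
    a * (Finset.univ.filter fun v ↦ G.degree v = a).card ≤
      (Finset.univ.filter fun v ↦ G.degree v = a).card +
        (Finset.univ.filter fun v ↦ G.degree v = b).card := by
  set A := Finset.univ.filter fun v ↦ G.degree v = a with hA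
  set B := Finset.univ.filter fun v ↦ G.degree v = b with hB
  have hbip : (degreePairGraph G a b).IsBipartiteWith (A : Set V) (B : Set V) := by
    refine ⟨?_, fun v w h ↦ by simpa [hA, hB] using h.2⟩
    rw [Finset.disjoint_coe, Finset.disjoint_filter]
    rintro v - rfl
    exact hab
  have hsupp : (degreePairGraph G a b).support ⊆ ((A ∪ B : Finset V) : Set V) := by
    rintro v ⟨w, -, h⟩
    simp only [hA, hB, Finset.coe_union, Finset.coe_filter, Set.mem_union]
    rcases h with h | h
    · exact Or.inl ⟨Finset.mem_univ _, h.1⟩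
    · exact Or.inr ⟨Finset.mem_univ _, h.1⟩
  have hsum := isBipartiteWith_sum_degrees_eq_card_edges hbip
  have hle := hacyc.card_edgeFinset_le_of_support_subset hsupp
  have hdeg : ∀ v ∈ A, (degreePairGraph G a b).degree v = a := by
    intro v hv
    have hv : G.degree v = a := (Finset.mem_filter.1 hv).2
    conv_rhs => rw [← hv]
    rw [← card_neighborFinset_eq_degree, ← card_neighborFinset_eq_degree]
    congr 1
    ext w
    simp only [mem_neighborFinset]
    exact ⟨fun h ↦ h.1, fun h ↦ ⟨h, Or.inl ⟨hv, hnbr v w h hv⟩⟩⟩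
  rw [Finset.sum_congr rfl hdeg, Finset.sum_const, smul_eq_mul, mul_comm] at hsum
  have := Finset.card_union_le A B
  lia

end Counting

/-- Every subgraph of a graph with maximum average degree less than four and maximum degree at
most `D`, where `D ≥ 5`, can be properly edge-colored from lists of size `D + 1`. -/
lemma exists_isProperListEdgeColoring {V : Type*} [Fintype V] {G : SimpleGraph V} {D : ℕ}
    (hD : 5 ≤ D) (hmad : MadLT G (4 : ℕ)) (hdeg : ∀ v, G.degree v ≤ D) {L : Sym2 V → Finset ℕ}
    (hL : ∀ e ∈ G.edgeSet, D + 1 ≤ (L e).card) (G' : SimpleGraph V) (hle : G' ≤ G) :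
    ∃ f, IsProperListEdgeColoring G' L f := by
  induction hN : G'.edgeFinset.card using Nat.strong_induction_on generalizing G' with
  | _ N ih =>
  have hD' (v : V) : G'.degree v ≤ D := (degree_le_of_le hle).trans (hdeg v)
  have hL' {u w : V} (h : G'.Adj u w) : D + 1 ≤ (L s(u, w)).card := hL _ (hle h)
  have hdel (C : Set (Sym2 V)) (u w : V) (h : G'.Adj u w) (hC : s(u, w) ∈ C) :
      ∃ f, IsProperListEdgeColoring (G'.deleteEdges C) L f := by
    have hlt : G'.deleteEdges C < G' := by
      refine lt_of_le_of_ne (deleteEdges_le C) fun heq ↦ ?_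
      rw [← heq, deleteEdges_adj] at h
      exact h.2 hC
    generalize G'.deleteEdges C = G'' at hlt
    refine ih _ ?_ G'' (hlt.le.trans hle) rfl
    rw [← hN]
    exact Finset.card_lt_card (edgeFinset_ssubset_edgeFinset.2 hlt)
  by_contra hcon
  have hedge (u w : V) (h : G'.Adj u w) : D + 3 ≤ G'.degree u + G'.degree w := by
    by_contra hlt
    obtain ⟨f, hf⟩ := hdel {s(u, w)} u w h rfl
    refine hcon (hf.extend_edge h rfl ?_)
    have := hL' h
    lia
  have hacyc : (degreePairGraph G' 3 D).IsAcyclic := by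
    intro u p hp
    obtain ⟨v, hper, hinj, hadj⟩ := hp.exists_periodic
    let col : (degreePairGraph G' 3 D).Coloring Bool :=
      Coloring.mk (fun v ↦ decide (G'.degree v = 3)) (by
        rintro x y ⟨-, ⟨hx, hy⟩ | ⟨hx, hy⟩⟩ <;> simp [hx, hy] <;> lia)
    have heven : Even p.length := (col.even_length_iff_congr p).2 Iff.rfl
    obtain ⟨f, hf⟩ := hdel (Set.range fun i ↦ s(v i, v (i + 1))) _ _ (hadj 0).1 ⟨0, rfl⟩
    refine hcon (hf.extend_cycle heven hp.three_le_length hper hinj (fun i ↦ (hadj i).1) rfl ?_)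
    intro i
    have := hL' (hadj i).1
    have := (hadj i).2
    lia
  have hne : G'.support.Nonempty := by
    by_contra h
    have hbot : G' = ⊥ := by
      rw [← support_eq_bot_iff]
      exact Set.not_nonempty_iff_eq_empty.1 h
    subst hbot
    exact hcon ⟨fun _ ↦ 0, by simp, by simp⟩
  have hlt := hmad.sum_degree_lt_s12 hle hne
  have hcount := mul_card_degree_le (by lia : 3 ≠ D)
    (fun u w h hu ↦ by
      have := hedge u w h
      have := hD' w
      lia) hacyc
  set S := G'.support.toFinset with hS
  have hmemS {v : V} (hv : 0 < G'.degree v) : v ∈ S := by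
    obtain ⟨w, hw⟩ := (degree_pos_iff_exists_adj ..).1 hv
    exact Set.mem_toFinset.2 ⟨w, hw⟩
  have hfilter {d : ℕ} (hd : 0 < d) :
      (Finset.univ.filter fun v ↦ G'.degree v = d) = S.filter fun v ↦ G'.degree v = d := by
    ext v
    simp only [Finset.mem_filter, Finset.mem_univ, true_and]
    exact ⟨fun h ↦ ⟨hmemS (h ▸ hd), h⟩, fun h ↦ h.2⟩
  rw [hfilter (by lia), hfilter (by lia)] at hcount
  have hsum : ∑ v ∈ S, (4 + if G'.degree v = D then 1 else 0) ≤
      ∑ v ∈ S, (G'.degree v + if G'.degree v = 3 then 1 else 0) := by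
    refine Finset.sum_le_sum fun v hv ↦ ?_
    obtain ⟨w, hw⟩ := Set.mem_toFinset.1 hv
    have := hedge v w hw
    have := hD' w
    split_ifs <;> lia
  rw [Finset.sum_add_distrib, Finset.sum_add_distrib, ← Finset.card_filter,
    ← Finset.card_filter, Finset.sum_const, smul_eq_mul] at hsum
  lia

theorem stmt_12 {V : Type*} [Fintype V] (G : SimpleGraph V) [DecidableRel G.Adj]
    (Δ : ℕ) (hΔ : G.maxDegree = Δ) (hΔ5 : 5 ≤ Δ) (hmad : MadLT G 4) :
    listChromaticIndex G ≤ Δ + 1 := by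
  refine Nat.sInf_le fun L hL ↦ ?_
  refine exists_isProperListEdgeColoring hΔ5 (by exact_mod_cast hmad) (fun v ↦ ?_) hL G le_rfl
  rw [← hΔ]
  convert G.degree_le_maxDegree v
end
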